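/- arXiv:1207.6907 — 14 statements merged into one kernel-verified Lean document; each statement's English description precedes it below -/
import Mathlib

section
/- Let q ≥ 1, let A, B ∈ ℂ^{q×q}, and let F : ℍ → ℂ^{q×q} be holomorphic with Im F(z) positive semidefinite for every z ∈ ℍ. Assume that for every z ∈ ℍ one has ker A ⊆ ker F(z) and range A = range F(z). Then the inverse (A,B)-Schur transform of the (A,B)-Schur transform of F equals F; explicitly, for every z ∈ ℍ, −A·(z·I_q + A⁺·(G(z) − B))⁺ = F(z), where G(z) := −A·(z·I_q + (F(z))⁺·A) + B. -/
open Matrix Complex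
open scoped ComplexOrder

/-- `Ap` satisfies the four Penrose equations for `A`, i.e. `Ap` is the Moore-Penrose
inverse of `A`. -/
def IsMoorePenrose {p q : ℕ} (A : Matrix (Fin p) (Fin q) ℂ)
    (Ap : Matrix (Fin q) (Fin p) ℂ) : Prop :=
  A * Ap * A = A ∧ Ap * A * Ap = Ap ∧ (A * Ap)ᴴ = A * Ap ∧ (Ap * A)ᴴ = Ap * A

/-- The "imaginary part" `(M - Mᴴ)/(2i)` of a square complex matrix. -/
noncomputable def matImag {q : ℕ} (M : Matrix (Fin q) (Fin q) ℂ) :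
    Matrix (Fin q) (Fin q) ℂ :=
  (2 * Complex.I)⁻¹ • (M - Mᴴ)

theorem proj_eq_aux {q : ℕ} (P Q : Matrix (Fin q) (Fin q) ℂ) (hP : Pᴴ = P) (hQ : Qᴴ = Q)
    (hPP : P * P = P) (hQQ : Q * Q = Q) (h : P * Q = P) (ht : P.trace = Q.trace) : Q = P := by
  have h' : Q * P = P := by
    have := congrArg conjTranspose h
    rwa [conjTranspose_mul, hP, hQ] at this
  have e : (Q - P)ᴴ * (Q - P) = Q - P := by
    rw [conjTranspose_sub, hP, hQ, sub_mul, mul_sub, mul_sub, hPP, hQQ, h, h']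
    abel
  have t : ((Q - P)ᴴ * (Q - P)).trace = 0 := by
    rw [e, trace_sub, ht, sub_self]
  exact sub_eq_zero.mp (trace_conjTranspose_mul_self_eq_zero_iff.mp t)

theorem ker_mat_aux {q : ℕ} (A F M : Matrix (Fin q) (Fin q) ℂ)
    (h : ∀ x, A.mulVec x = 0 → F.mulVec x = 0) (hM : A * M = 0) : F * M = 0 := by
  apply Matrix.ext_of_mulVec_single
  intro i
  rw [← mulVec_mulVec, h _ (by rw [mulVec_mulVec, hM, zero_mulVec]), zero_mulVec]

theorem ran_mat_aux {q : ℕ} (A F M : Matrix (Fin q) (Fin q) ℂ)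
    (h : Set.range F.mulVec ⊆ Set.range A.mulVec) (hM : M * A = A) : M * F = F := by
  apply Matrix.ext_of_mulVec_single
  intro i
  obtain ⟨y, hy⟩ := h ⟨_, rfl⟩
  rw [← mulVec_mulVec, ← hy, mulVec_mulVec, hM]

theorem ker_conj_aux {q : ℕ} (F : Matrix (Fin q) (Fin q) ℂ) (h : (matImag F).PosSemidef)
    (x : Fin q → ℂ) (hx : F.mulVec x = 0) : Fᴴ.mulVec x = 0 := by
  have h0 : star x ⬝ᵥ (matImag F).mulVec x = 0 := by
    have : star x ⬝ᵥ Fᴴ.mulVec x = 0 := by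
      rw [dotProduct_mulVec, ← star_mulVec, hx]; simp
    rw [matImag, smul_mulVec, sub_mulVec, hx, dotProduct_smul, dotProduct_sub, this]; simp
  have h1 := (h.dotProduct_mulVec_zero_iff x).mp h0
  rw [matImag, smul_mulVec, sub_mulVec, hx] at h1
  simpa using h1

/-- if `F` is a Herglotz–Nevanlinna function with `ker A ⊆ ker F(z)` and
`range A = range F(z)` on the upper half-plane, then the inverse `(A,B)`-Schur transform
of the `(A,B)`-Schur transform `G` of `F` is `F` itself. -/
theorem inverse_schur_of_schur
    (q : ℕ) (hq : 1 ≤ q)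
    (A B Ap : Matrix (Fin q) (Fin q) ℂ)
    (hAp : IsMoorePenrose A Ap)
    (F Fp : ℂ → Matrix (Fin q) (Fin q) ℂ)
    (hHolo : ∀ i j, DifferentiableOn ℂ (fun z => F z i j) {z : ℂ | 0 < z.im})
    (hPSD : ∀ z : ℂ, 0 < z.im → (matImag (F z)).PosSemidef)
    (hFp : ∀ z : ℂ, 0 < z.im → IsMoorePenrose (F z) (Fp z))
    (hker : ∀ z : ℂ, 0 < z.im →
      {x : Fin q → ℂ | A.mulVec x = 0} ⊆ {x | (F z).mulVec x = 0})
    (hran : ∀ z : ℂ, 0 < z.im → Set.range A.mulVec = Set.range (F z).mulVec)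
    (G : ℂ → Matrix (Fin q) (Fin q) ℂ)
    (hG : ∀ z : ℂ, G z = -(A * (z • (1 : Matrix (Fin q) (Fin q) ℂ) + Fp z * A)) + B)
    (Gp : ℂ → Matrix (Fin q) (Fin q) ℂ)
    (hGp : ∀ z : ℂ, 0 < z.im →
      IsMoorePenrose (z • (1 : Matrix (Fin q) (Fin q) ℂ) + Ap * (G z - B)) (Gp z)) :
    ∀ z : ℂ, 0 < z.im → -(A * Gp z) = F z := by
  intro z hz
  obtain ⟨a1, a2, a3, a4⟩ := hAp
  obtain ⟨f1, f2, f3, f4⟩ := hFp z hz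
  have hW := hGp z hz
  rw [hG] at hW
  have hk := hker z hz
  have hr := hran z hz
  have hps := hPSD z hz
  generalize F z = F at *
  generalize Fp z = X at *
  generalize Gp z = Y at *
  have z0 : z ≠ 0 := by rintro rfl; simp at hz
  -- A A⁺ = F F⁺
  have c1 : A * Ap * F = F := ran_mat_aux A F _ hr.ge a1
  have c2 : F * X * A = A := ran_mat_aux F A _ hr.le f1
  have e1 : A * Ap = F * X := by
    have u : (A * Ap) * (F * X) = F * X := by rw [← mul_assoc, c1]
    have v : (F * X) * (A * Ap) = A * Ap := by rw [← mul_assoc, c2]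
    have := congrArg conjTranspose v
    rw [conjTranspose_mul, a3, f3] at this
    rw [← this, u]
  have hPP : (F * X) * (F * X) = F * X := by rw [← mul_assoc, f1]
  have hEE : (X * F) * (X * F) = X * F := by rw [← mul_assoc, f2]
  have hQQ : (Ap * A) * (Ap * A) = Ap * A := by rw [← mul_assoc, a2]
  have e2 : X * F = F * X := by
    have k : Fᴴ * (1 - X * F) = 0 := by
      apply ker_mat_aux F _ _ (ker_conj_aux F hps)
      rw [mul_sub, mul_one, ← mul_assoc, f1, sub_self]
    have k2 := congrArg conjTranspose k
    rw [conjTranspose_mul, conjTranspose_sub, f4, conjTranspose_conjTranspose, sub_mul,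
      conjTranspose_zero, conjTranspose_one, one_mul, sub_eq_zero] at k2
    have k3 : (X * F) * (F * X) = F * X := by rw [← mul_assoc, ← k2]
    have k4 := congrArg conjTranspose k3
    rw [conjTranspose_mul, f3, f4] at k4
    exact proj_eq_aux _ _ f3 f4 hPP hEE k4 (trace_mul_comm _ _)
  have e3 : Ap * A = F * X := by
    have k : F * (1 - Ap * A) = 0 := by
      apply ker_mat_aux A _ _ (fun x hx => hk hx)
      rw [mul_sub, mul_one, ← mul_assoc, a1, sub_self]
    rw [mul_sub, mul_one, sub_eq_zero] at k
    refine proj_eq_aux _ _ f3 a4 hPP hQQ ?_ ?_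
    · rw [← e2, mul_assoc, ← k]
    · rw [← e1, trace_mul_comm]
  obtain ⟨P, hP⟩ : ∃ P, P = F * X := ⟨_, rfl⟩
  rw [← hP] at e1 e2 e3 hPP f1
  have PAp : P * Ap = Ap := by rw [← e3, a2]
  have AP : A * P = A := by rw [← e3, ← mul_assoc, a1]
  have PX : P * X = X := by rw [← e2, f2]
  have PF : P * F = F := f1
  have w : z • (1 : Matrix (Fin q) (Fin q) ℂ) + Ap * (-(A * (z • 1 + X * A)) + B - B)
      = z • (1 - P) - X * A := by
    rw [add_sub_cancel_right, mul_neg, ← mul_assoc, e3, mul_add, ← mul_assoc, PX, mul_smul_comm,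
      mul_one, smul_sub]
    abel
  rw [w] at hW
  obtain ⟨V, hV⟩ : ∃ V, V = z⁻¹ • (1 - P) - Ap * F := ⟨_, rfl⟩
  have s1 : (1 - P) * (1 - P) = 1 - P := by
    rw [sub_mul, one_mul, mul_sub, mul_one, hPP, sub_self, sub_zero]
  have s2 : (1 - P) * (Ap * F) = 0 := by
    rw [← mul_assoc, sub_mul, PAp]; simp
  have s3 : X * A * (1 - P) = 0 := by
    rw [mul_assoc, mul_sub, AP]; simp
  have s4 : X * A * (Ap * F) = P := by
    rw [mul_assoc, ← mul_assoc A, e1, PF, e2]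
  have WV : (z • (1 - P) - X * A) * V = 1 := by
    rw [hV, sub_mul, mul_sub, mul_sub, smul_mul_smul_comm, s1, smul_mul_assoc, s2, mul_smul_comm,
      s3, s4, mul_inv_cancel₀ z0]
    simp
  have VW := mul_eq_one_comm.mp WV
  have hY : Y = V := by
    have g := hW.1
    generalize z • (1 - P) - X * A = W at *
    calc Y = (V * W) * Y * (W * V) := by rw [VW, WV]; simp
      _ = V * (W * Y * W) * V := by simp only [mul_assoc]
      _ = V := by rw [g, VW, one_mul]
  rw [hY, hV, mul_sub, mul_smul_comm, mul_sub, AP, ← mul_assoc, e1, PF]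
  simp
end

section
/- Let q ≥ 1, let A ∈ ℂ^{q×q} be positive semidefinite, and let B ∈ ℂ^{q×q} be Hermitian with ker A ⊆ ker B. Let F : ℍ → ℂ^{q×q} be holomorphic with Im F(z) positive semidefinite and ker A ⊆ ker F(z) for every z ∈ ℍ. Then the (A,B)-Schur transform of the inverse (A,B)-Schur transform of F equals F; explicitly, for every z ∈ ℍ, −A·(z·I_q + (Y(z))⁺·A) + B = F(z), where Y(z) := −A·(z·I_q + A⁺·(F(z) − B))⁺. -/
open Matrix Complex
open scoped ComplexOrder

theorem mp_unique {q : ℕ} {A X Z : Matrix (Fin q) (Fin q) ℂ}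
    (hX : IsMoorePenrose A X) (hZ : IsMoorePenrose A Z) : X = Z := by
  obtain ⟨x1, x2, x3, x4⟩ := hX
  obtain ⟨z1, z2, z3, z4⟩ := hZ
  have e1 : A * X = A * Z := by
    calc A * X = (A * Z) * (A * X) := by rw [← Matrix.mul_assoc, z1]
      _ = (A * Z)ᴴ * (A * X)ᴴ := by rw [x3, z3]
      _ = ((A * X) * (A * Z))ᴴ := by rw [← Matrix.conjTranspose_mul]
      _ = A * Z := by rw [← Matrix.mul_assoc, x1, z3]
  have e2 : X * A = Z * A := by
    calc X * A = (X * A) * (Z * A) := by rw [Matrix.mul_assoc, ← Matrix.mul_assoc A, z1]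
      _ = (X * A)ᴴ * (Z * A)ᴴ := by rw [x4, z4]
      _ = ((Z * A) * (X * A))ᴴ := by rw [← Matrix.conjTranspose_mul]
      _ = Z * A := by rw [Matrix.mul_assoc, ← Matrix.mul_assoc A, x1, z4]
  calc X = X * A * X := x2.symm
    _ = Z * A * Z := by rw [Matrix.mul_assoc, e1, ← Matrix.mul_assoc, e2]
    _ = Z := z2

theorem mul_zero_of_ker {q : ℕ} {A G D : Matrix (Fin q) (Fin q) ℂ}
    (h : ∀ x, A.mulVec x = 0 → G.mulVec x = 0) (hD : A * D = 0) : G * D = 0 := by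
  apply Matrix.ext_of_mulVec_single
  intro i
  rw [← Matrix.mulVec_mulVec, Matrix.zero_mulVec]
  apply h
  rw [Matrix.mulVec_mulVec, hD, Matrix.zero_mulVec]

/-- for `A` PSD, `B` Hermitian with `ker A ⊆ ker B` and a Herglotz–Nevanlinna
function `F` with `ker A ⊆ ker F(z)` on the upper half-plane, the `(A,B)`-Schur transform
of the inverse `(A,B)`-Schur transform `Y` of `F` is `F` itself. -/
theorem schur_of_inverse_schur
    (q : ℕ) (hq : 1 ≤ q)
    (A B Ap : Matrix (Fin q) (Fin q) ℂ)
    (hA : A.PosSemidef) (hB : B.IsHermitian)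
    (hAp : IsMoorePenrose A Ap)
    (hkerAB : {x : Fin q → ℂ | A.mulVec x = 0} ⊆ {x | B.mulVec x = 0})
    (F : ℂ → Matrix (Fin q) (Fin q) ℂ)
    (hHolo : ∀ i j, DifferentiableOn ℂ (fun z => F z i j) {z : ℂ | 0 < z.im})
    (hPSD : ∀ z : ℂ, 0 < z.im → (matImag (F z)).PosSemidef)
    (hker : ∀ z : ℂ, 0 < z.im →
      {x : Fin q → ℂ | A.mulVec x = 0} ⊆ {x | (F z).mulVec x = 0})
    (Mi : ℂ → Matrix (Fin q) (Fin q) ℂ)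
    (hMi : ∀ z : ℂ, 0 < z.im →
      IsMoorePenrose (z • (1 : Matrix (Fin q) (Fin q) ℂ) + Ap * (F z - B)) (Mi z))
    (Y : ℂ → Matrix (Fin q) (Fin q) ℂ)
    (hY : ∀ z : ℂ, Y z = -(A * Mi z))
    (Yp : ℂ → Matrix (Fin q) (Fin q) ℂ)
    (hYp : ∀ z : ℂ, 0 < z.im → IsMoorePenrose (Y z) (Yp z)) :
    ∀ z : ℂ, 0 < z.im →
      -(A * (z • (1 : Matrix (Fin q) (Fin q) ℂ) + Yp z * A)) + B = F z := by
  intro z hz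
  have hYz := hYp z hz
  rw [hY z] at hYz
  have hM := hMi z hz
  have hIm := hPSD z hz
  have hk := hker z hz
  generalize F z = F at *
  generalize Mi z = M at *
  generalize Yp z = N at *
  have hAH : Aᴴ = A := hA.1
  have hApH : Apᴴ = Ap := by
    apply mp_unique (A := A) _ hAp
    obtain ⟨a1, a2, a3, a4⟩ := hAp
    refine ⟨?_, ?_, ?_, ?_⟩
    · have := congrArg conjTranspose a1
      simpa [hAH, Matrix.mul_assoc] using this
    · have := congrArg conjTranspose a2
      simpa [hAH, Matrix.mul_assoc] using this
    · simpa [hAH] using a4.symm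
    · simpa [hAH] using a3.symm
  obtain ⟨a1, a2, a3, a4⟩ := hAp
  have hcomm : A * Ap = Ap * A := by
    rw [← a3, conjTranspose_mul, hApH, hAH]
  have hD : A * (1 - Ap * A) = 0 := by
    rw [mul_sub, mul_one, ← Matrix.mul_assoc, a1, sub_self]
  have hIF : ∀ x, F - Fᴴ = (2 * Complex.I) • matImag F ∧
      (F.mulVec x = 0 → Fᴴ.mulVec x = 0) := by
    intro x
    have h1 : F - Fᴴ = (2 * Complex.I) • matImag F := by
      unfold matImag
      rw [smul_smul, mul_inv_cancel₀ (by simp), one_smul]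
    refine ⟨h1, fun hx => ?_⟩
    have h2 : star x ⬝ᵥ (matImag F).mulVec x = 0 := by
      unfold matImag
      rw [Matrix.smul_mulVec, Matrix.sub_mulVec, hx, zero_sub, dotProduct_smul, dotProduct_neg,
        Matrix.dotProduct_mulVec, ← Matrix.star_mulVec, hx]
      simp
    have h3 := (hIm.dotProduct_mulVec_zero_iff x).1 h2
    have h4 := congrArg (fun T => T.mulVec x) h1
    simp only [Matrix.sub_mulVec, Matrix.smul_mulVec, h3, hx, smul_zero, zero_sub] at h4
    exact neg_eq_zero.1 h4
  have hBz : B * (1 - Ap * A) = 0 := mul_zero_of_ker (fun x hx => hkerAB hx) hD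
  have hFz : F * (1 - Ap * A) = 0 := mul_zero_of_ker (fun x hx => hk hx) hD
  have hFz' : Fᴴ * (1 - Ap * A) = 0 := mul_zero_of_ker (fun x hx => (hIF x).2 (hk hx)) hD
  have hGP : (F - B) * (Ap * A) = F - B := by
    have : (F - B) * (1 - Ap * A) = 0 := by rw [Matrix.sub_mul, hBz, hFz, sub_zero]
    rw [mul_sub, mul_one] at this
    exact (sub_eq_zero.1 this).symm
  have hPG : A * Ap * (F - B) = F - B := by
    have : (F - B)ᴴ * (1 - Ap * A) = 0 := by
      rw [conjTranspose_sub, hB.eq, Matrix.sub_mul, hBz, hFz', sub_zero]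
    have := congrArg conjTranspose this
    rw [conjTranspose_mul, conjTranspose_conjTranspose, conjTranspose_sub, a4,
      conjTranspose_one, conjTranspose_zero, Matrix.sub_mul, Matrix.one_mul, ← hcomm] at this
    exact (sub_eq_zero.1 this).symm
  have hAW : A * (z • (1 : Matrix (Fin q) (Fin q) ℂ) + Ap * (F - B)) = z • A + (F - B) := by
    rw [Matrix.mul_add, ← Matrix.mul_assoc, hPG]; simp
  have hWP : (z • (1 : Matrix (Fin q) (Fin q) ℂ) + Ap * (F - B)) * (Ap * A)
      = Ap * A * (z • (1 : Matrix (Fin q) (Fin q) ℂ) + Ap * (F - B)) := by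
    rw [Matrix.mul_assoc Ap, hAW, Matrix.add_mul, Matrix.mul_assoc Ap, hGP, Matrix.mul_add]
    simp
  have hWinj : ∀ x, (z • (1 : Matrix (Fin q) (Fin q) ℂ) + Ap * (F - B)).mulVec x = 0 → x = 0 := by
    intro x hx
    have h1 : (z • A + (F - B)).mulVec x = 0 := by
      rw [← hAW, ← Matrix.mulVec_mulVec, hx, Matrix.mulVec_zero]
    have h2 : z * (star x ⬝ᵥ A.mulVec x) + (star x ⬝ᵥ F.mulVec x - star x ⬝ᵥ B.mulVec x) = 0 := by
      have := congrArg (fun v => star x ⬝ᵥ v) h1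
      simpa [Matrix.add_mulVec, Matrix.sub_mulVec, Matrix.smul_mulVec, dotProduct_add,
        dotProduct_sub] using this
    have hAx := hA.dotProduct_mulVec_nonneg x
    have hFx := hIm.dotProduct_mulVec_nonneg x
    have hst : ∀ T : Matrix (Fin q) (Fin q) ℂ,
        star x ⬝ᵥ Tᴴ.mulVec x = star (star x ⬝ᵥ T.mulVec x) := by
      intro T
      rw [Matrix.star_dotProduct, Matrix.star_mulVec, conjTranspose_conjTranspose,
        ← Matrix.dotProduct_mulVec]
    have hBx : (star x ⬝ᵥ B.mulVec x).im = 0 := by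
      have := hst B
      rw [hB.eq] at this
      have := congrArg Complex.im this
      simp at this
      linarith
    have hFi : (star x ⬝ᵥ F.mulVec x).im = (star x ⬝ᵥ (matImag F).mulVec x).re := by
      have := congrArg (fun T => star x ⬝ᵥ T.mulVec x) (hIF x).1
      simp only [Matrix.sub_mulVec, Matrix.smul_mulVec, dotProduct_sub, dotProduct_smul,
        hst F] at this
      have := congrArg Complex.im this
      simp at this
      linarith
    rw [Complex.nonneg_iff] at hAx hFx
    have h3 := congrArg Complex.im h2
    simp only [Complex.add_im, Complex.mul_im, Complex.sub_im, hBx, hFi, ← hAx.2,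
      Complex.zero_im] at h3
    have h4 : (star x ⬝ᵥ A.mulVec x).re = 0 := by
      have h5 := hAx.1
      have h6 := hFx.1
      nlinarith [mul_nonneg hz.le h5]
    have h5 : A.mulVec x = 0 :=
      (hA.dotProduct_mulVec_zero_iff x).1 (Complex.ext h4 hAx.2.symm)
    have h6 : F.mulVec x = 0 := hk h5
    have h7 : B.mulVec x = 0 := hkerAB h5
    rw [Matrix.add_mulVec, ← Matrix.mulVec_mulVec, Matrix.sub_mulVec, h6, h7, sub_zero,
      Matrix.mulVec_zero, add_zero, Matrix.smul_mulVec, Matrix.one_mulVec] at hx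
    rcases smul_eq_zero.1 hx with h | h
    · rw [h] at hz; simp at hz
    · exact h
  generalize z • (1 : Matrix (Fin q) (Fin q) ℂ) + Ap * (F - B) = W at *
  have hMW : M * W = 1 := by
    have : W * (M * W - 1) = 0 := by
      rw [mul_sub, ← Matrix.mul_assoc, hM.1, mul_one, sub_self]
    have : (1 : Matrix (Fin q) (Fin q) ℂ) * (M * W - 1) = 0 :=
      mul_zero_of_ker (fun x hx => by rw [hWinj x hx, Matrix.mulVec_zero]) this
    rw [one_mul] at this
    exact sub_eq_zero.1 this
  have hWM : W * M = 1 := mul_eq_one_comm.1 hMW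
  have e1 : (A * M) * (W * Ap) = A * Ap := by
    rw [Matrix.mul_assoc, ← Matrix.mul_assoc M, hMW, one_mul]
  have e2 : (W * Ap) * (A * M) = Ap * A := by
    calc (W * Ap) * (A * M) = W * (Ap * A) * M := by simp only [Matrix.mul_assoc]
      _ = Ap * A := by rw [hWP, Matrix.mul_assoc, hWM, mul_one]
  have hN : N = -(W * Ap) := by
    apply mp_unique hYz
    refine ⟨?_, ?_, ?_, ?_⟩
    · rw [neg_mul_neg, e1, mul_neg, ← Matrix.mul_assoc, a1]
    · rw [neg_mul_neg, e2, mul_neg, ← Matrix.mul_assoc, ← hWP, Matrix.mul_assoc, a2]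
    · rw [neg_mul_neg, e1, a3]
    · rw [neg_mul_neg, e2, a4]
  have e3 : A * (W * Ap * A) = z • A + (F - B) := by
    rw [Matrix.mul_assoc W, hWP, ← Matrix.mul_assoc, ← Matrix.mul_assoc, a1, hAW]
  rw [hN, neg_mul, Matrix.mul_add, mul_neg, e3]
  simp
end

section
/- Let q ≥ 1, let A ∈ ℂ^{q×q} be positive semidefinite, and let B ∈ ℂ^{q×q} be Hermitian with ker A ⊆ ker B. Let F : ℍ → ℂ^{q×q} be holomorphic with Im F(z) positive semidefinite and ker A ⊆ ker F(z) for every z ∈ ℍ. Define H(z) := −B + z·A + F(z) and Y(z) := −A·(z·I_q + A⁺·(F(z) − B))⁺ (the inverse (A,B)-Schur transform of F). Then for every z ∈ ℍ: (1) ker H(z) ⊆ ker A ⊆ ker(F(z) − B); (2) the matrix z·I_q + A⁺·(F(z) − B) is invertible; (3) Y(z) = −A·(z·I_q + A⁺·(F(z) − B))^{−1} = −A·(H(z))⁺·A; (4) range Y(z) = range A and ker Y(z) = ker A; (5) if A is invertible, then Y(z) is invertible. -/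
open Matrix Complex
open scoped ComplexOrder

theorem aux_mul_zero {q : ℕ} (A C D : Matrix (Fin q) (Fin q) ℂ)
    (h : ∀ x : Fin q → ℂ, A *ᵥ x = 0 → C *ᵥ x = 0) (hD : A * D = 0) : C * D = 0 := by
  ext i j
  have h1 : A *ᵥ (fun k => D k j) = 0 := by
    funext k
    exact congrFun (congrFun hD k) j
  exact congrFun (h _ h1) i

theorem aux_im {q : ℕ} (M : Matrix (Fin q) (Fin q) ℂ) :
    M = Mᴴ + (2 * Complex.I) • matImag M := by
  have h2 : (2 * Complex.I) ≠ 0 := by simp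
  rw [matImag, smul_smul, mul_inv_cancel₀ h2, one_smul]
  abel

theorem aux_quad_im {q : ℕ} (M : Matrix (Fin q) (Fin q) ℂ) (x : Fin q → ℂ) :
    star x ⬝ᵥ (matImag M *ᵥ x) = ((star x ⬝ᵥ (M *ᵥ x)).im : ℂ) := by
  have h : star x ⬝ᵥ (Mᴴ *ᵥ x) = star (star x ⬝ᵥ (M *ᵥ x)) := by
    rw [← star_dotProduct_star, star_star, star_mulVec, dotProduct_mulVec]
  rw [matImag, smul_mulVec, sub_mulVec, dotProduct_smul, dotProduct_sub, h]
  apply Complex.ext <;> simp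
  ring

/-- structure of the inverse `(A,B)`-Schur transform
`Y(z) = -A (z I + A⁺(F(z)-B))⁺` of a Herglotz–Nevanlinna function `F` with
`ker A ⊆ ker F(z)`, where `A` is PSD and `B` is Hermitian with `ker A ⊆ ker B`. -/
theorem inverse_schur_transform_structure
    (q : ℕ) (hq : 1 ≤ q)
    (A B Ap : Matrix (Fin q) (Fin q) ℂ)
    (hA : A.PosSemidef) (hB : B.IsHermitian)
    (hAp : IsMoorePenrose A Ap)
    (hkerAB : {x : Fin q → ℂ | A.mulVec x = 0} ⊆ {x | B.mulVec x = 0})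
    (F : ℂ → Matrix (Fin q) (Fin q) ℂ)
    (hHolo : ∀ i j, DifferentiableOn ℂ (fun z => F z i j) {z : ℂ | 0 < z.im})
    (hPSD : ∀ z : ℂ, 0 < z.im → (matImag (F z)).PosSemidef)
    (hker : ∀ z : ℂ, 0 < z.im →
      {x : Fin q → ℂ | A.mulVec x = 0} ⊆ {x | (F z).mulVec x = 0})
    (Hf : ℂ → Matrix (Fin q) (Fin q) ℂ)
    (hHf : ∀ z : ℂ, Hf z = -B + z • A + F z)
    (Hp : ℂ → Matrix (Fin q) (Fin q) ℂ)
    (hHp : ∀ z : ℂ, 0 < z.im → IsMoorePenrose (Hf z) (Hp z))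
    (Mi : ℂ → Matrix (Fin q) (Fin q) ℂ)
    (hMi : ∀ z : ℂ, 0 < z.im →
      IsMoorePenrose (z • (1 : Matrix (Fin q) (Fin q) ℂ) + Ap * (F z - B)) (Mi z))
    (Y : ℂ → Matrix (Fin q) (Fin q) ℂ)
    (hY : ∀ z : ℂ, Y z = -(A * Mi z)) :
    ∀ z : ℂ, 0 < z.im →
      ({x : Fin q → ℂ | (Hf z).mulVec x = 0} ⊆ {x | A.mulVec x = 0}
        ∧ {x : Fin q → ℂ | A.mulVec x = 0} ⊆ {x | (F z - B).mulVec x = 0})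
      ∧ IsUnit (z • (1 : Matrix (Fin q) (Fin q) ℂ) + Ap * (F z - B))
      ∧ (Y z = -(A * (z • (1 : Matrix (Fin q) (Fin q) ℂ) + Ap * (F z - B))⁻¹)
         ∧ Y z = -(A * Hp z * A))
      ∧ (Set.range (Y z).mulVec = Set.range A.mulVec
         ∧ {x : Fin q → ℂ | (Y z).mulVec x = 0} = {x | A.mulVec x = 0})
      ∧ (IsUnit A → IsUnit (Y z)) := by
  intro z hz
  obtain ⟨hA1, hA2, hA3, hA4⟩ := hAp
  have hAF : ∀ x : Fin q → ℂ, A *ᵥ x = 0 → F z *ᵥ x = 0 := fun x hx => hker z hz hx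
  have hAB : ∀ x : Fin q → ℂ, A *ᵥ x = 0 → B *ᵥ x = 0 := fun x hx => hkerAB hx
  have hAG : ∀ x : Fin q → ℂ, A *ᵥ x = 0 → (F z - B) *ᵥ x = 0 := fun x hx => by
    rw [sub_mulVec, hAF x hx, hAB x hx, sub_zero]
  have hAFH : ∀ x : Fin q → ℂ, A *ᵥ x = 0 → (F z)ᴴ *ᵥ x = 0 := fun x hx => by
    have h0 : matImag (F z) *ᵥ x = 0 := by
      rw [← (hPSD z hz).dotProduct_mulVec_zero_iff, aux_quad_im, hAF x hx]
      simp
    have h1 := hAF x hx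
    rw [aux_im (F z), add_mulVec, smul_mulVec, h0, smul_zero, add_zero] at h1
    exact h1
  have hAGH : ∀ x : Fin q → ℂ, A *ᵥ x = 0 → (F z - B)ᴴ *ᵥ x = 0 := fun x hx => by
    rw [conjTranspose_sub, hB.eq, sub_mulVec, hAFH x hx, hAB x hx, sub_zero]
  have hHA : ∀ x : Fin q → ℂ, Hf z *ᵥ x = 0 → A *ᵥ x = 0 := fun x hx => by
    have hIm : matImag (Hf z) = (z.im : ℂ) • A + matImag (F z) := by
      have h2 : (2 * Complex.I) ≠ 0 := by simp
      have h3 : z - star z = (2 * Complex.I) * (z.im : ℂ) := by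
        apply Complex.ext <;> simp
        ring
      rw [matImag, matImag, hHf, conjTranspose_add, conjTranspose_add, conjTranspose_neg,
        conjTranspose_smul, hB.eq, hA.1.eq]
      have h4 : -B + z • A + F z - (-B + star z • A + (F z)ᴴ)
          = (z - star z) • A + (F z - (F z)ᴴ) := by
        rw [sub_smul]; abel
      rw [h4, h3, smul_add, smul_smul, inv_mul_cancel_left₀ h2]
    have h := aux_quad_im (Hf z) x
    rw [hx, hIm, add_mulVec, dotProduct_add, smul_mulVec, dotProduct_smul] at h
    have p1 := hA.dotProduct_mulVec_nonneg x
    have p2 := (hPSD z hz).dotProduct_mulVec_nonneg x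
    rw [← hA.dotProduct_mulVec_zero_iff]
    have hz' : (0 : ℂ) < (z.im : ℂ) := by exact_mod_cast hz
    have p3 : 0 ≤ (z.im : ℂ) • (star x ⬝ᵥ (A *ᵥ x)) := mul_nonneg hz'.le p1
    simp only [dotProduct_zero, Complex.zero_im, Complex.ofReal_zero] at h
    have h5 := ((add_eq_zero_iff_of_nonneg p3 p2).1 h).1
    rcases mul_eq_zero.1 h5 with h6 | h6
    · exact absurd h6 hz'.ne'
    · exact h6
  have hAAp : A * (A * Ap) = A := by
    have := congrArg conjTranspose hA1
    rwa [conjTranspose_mul, hA3, hA.1.eq] at this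
  have hAApG : A * Ap * (F z - B) = F z - B := by
    have h1 : (F z - B)ᴴ * (1 - A * Ap) = 0 := by
      apply aux_mul_zero A _ _ hAGH
      rw [mul_sub, mul_one, hAAp, sub_self]
    have := congrArg conjTranspose h1
    rw [conjTranspose_mul, conjTranspose_conjTranspose, conjTranspose_sub, hA3,
      conjTranspose_one, conjTranspose_zero, sub_mul, one_mul, sub_eq_zero] at this
    exact this.symm
  have hz0 : z ≠ 0 := by
    rintro rfl
    simp at hz
  have hMi' := hMi z hz
  have hYz := hY z
  set M := z • (1 : Matrix (Fin q) (Fin q) ℂ) + Ap * (F z - B) with hM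
  have hMx : ∀ x : Fin q → ℂ, A *ᵥ x = 0 → M *ᵥ x = z • x := fun x hx => by
    rw [hM, add_mulVec, smul_mulVec, one_mulVec, ← mulVec_mulVec, hAG x hx, mulVec_zero, add_zero]
  have hAM : A * M = Hf z := by
    rw [hM, hHf, mul_add, mul_smul_comm, mul_one, ← mul_assoc, hAApG]
    abel
  have hMu : IsUnit M := by
    rw [← mulVec_injective_iff_isUnit]
    rw [injective_iff_map_eq_zero (mulVecLin M) |> fun h => (show Function.Injective M.mulVec ↔ _ from h)]
    intro x hx
    have hx' : M *ᵥ x = 0 := hx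
    have h1 : A *ᵥ x = 0 := by
      apply hHA
      rw [← hAM, ← mulVec_mulVec, hx', mulVec_zero]
    rw [hMx x h1] at hx'
    exact (smul_eq_zero.1 hx').resolve_left hz0
  have hdet : IsUnit M.det := (isUnit_iff_isUnit_det M).1 hMu
  have hMiInv : Mi z = M⁻¹ := by
    have h1 := hMi'.1
    have h2 : M * Mi z = 1 := by
      have := congrArg (· * M⁻¹) h1
      simpa [mul_assoc, mul_nonsing_inv M hdet] using this
    exact (inv_eq_right_inv h2).symm
  have hY1 : Y z = -(A * M⁻¹) := by rw [hYz, hMiInv]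
  have hAHp : A * Hp z * Hf z = A := by
    have h1 : A * (1 - Hp z * Hf z) = 0 := by
      apply aux_mul_zero (Hf z) _ _ hHA
      rw [mul_sub, mul_one, ← mul_assoc, (hHp z hz).1, sub_self]
    rw [mul_sub, mul_one, sub_eq_zero, ← mul_assoc] at h1
    exact h1.symm
  have hY2 : Y z = -(A * Hp z * A) := by
    rw [hY1]
    congr 1
    calc A * M⁻¹ = A * Hp z * Hf z * M⁻¹ := by rw [hAHp]
      _ = A * Hp z * A * (M * M⁻¹) := by rw [← hAM]; simp only [mul_assoc]
      _ = _ := by rw [mul_nonsing_inv M hdet, mul_one]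
  have hYM : Y z * M = -A := by
    rw [hY1, neg_mul, mul_assoc, nonsing_inv_mul M hdet, mul_one]
  refine ⟨⟨fun x hx => hHA x hx, fun x hx => hAG x hx⟩, hMu, ⟨hY1, hY2⟩, ⟨?_, ?_⟩, ?_⟩
  · ext y
    constructor
    · rintro ⟨x, rfl⟩
      refine ⟨-(M⁻¹ *ᵥ x), ?_⟩
      rw [hY1, mulVec_neg, neg_mulVec, mulVec_mulVec]
    · rintro ⟨x, rfl⟩
      refine ⟨-(M *ᵥ x), ?_⟩
      rw [mulVec_neg, mulVec_mulVec, hYM, neg_mulVec, neg_neg]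
  · ext x
    constructor
    · intro hx
      have hx' : Y z *ᵥ x = 0 := hx
      rw [hY1, neg_mulVec, neg_eq_zero, ← mulVec_mulVec] at hx'
      have h1 := hMx _ hx'
      rw [mulVec_mulVec, mul_nonsing_inv M hdet, one_mulVec] at h1
      change A *ᵥ x = 0
      rw [h1, mulVec_smul, hx', smul_zero]
    · intro hx
      have hx' : A *ᵥ x = 0 := hx
      change Y z *ᵥ x = 0
      rw [hY2, neg_mulVec, ← mulVec_mulVec, hx', mulVec_zero, neg_zero]
  · intro hu
    rw [hY1]
    exact (hu.mul ((isUnit_nonsing_inv_iff).2 hMu)).neg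
end

section
/- Let q ≥ 1, let A ∈ ℂ^{q×q} be positive semidefinite, let B ∈ ℂ^{q×q}, and let X ∈ ℂ^{q×q} be such that Im(X − B) is positive semidefinite, ker A ⊆ ker(X − B), and range(X − B) ⊆ range A. Let z ∈ ℂ with Im z > 0. Then: (a) Im(X + z·A − B) − (Im z)·A is positive semidefinite, and (Im z)·A is positive semidefinite; (b) ker(X + z·A − B) ⊆ ker A; (c) X + z·A − B = A·(A⁺·X + z·I_q − A⁺·B); (d) the matrix A⁺·X + z·I_q − A⁺·B is invertible, −A·(A⁺·X + z·I_q − A⁺·B)^{−1} = −A·(X + z·A − B)⁺·A, and ker A ⊆ ker(−A·(X + z·A − B)⁺·A). -/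
open Matrix Complex
open scoped ComplexOrder

/-- for `A` PSD and `X` with `Im(X-B)` PSD, `ker A ⊆ ker (X-B)` and
`range (X-B) ⊆ range A`, and `z` in the open upper half-plane, various structural facts
about `X + z A - B` hold. -/
theorem matrix_pencil_structure
    (q : ℕ) (hq : 1 ≤ q)
    (A B X Ap Wp : Matrix (Fin q) (Fin q) ℂ)
    (hA : A.PosSemidef)
    (hAp : IsMoorePenrose A Ap)
    (z : ℂ) (hz : 0 < z.im)
    (hImXB : (matImag (X - B)).PosSemidef)
    (hker : {x : Fin q → ℂ | A.mulVec x = 0} ⊆ {x | (X - B).mulVec x = 0})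
    (hran : Set.range (X - B).mulVec ⊆ Set.range A.mulVec)
    (hWp : IsMoorePenrose (X + z • A - B) Wp) :
    ((matImag (X + z • A - B) - (z.im : ℂ) • A).PosSemidef
      ∧ ((z.im : ℂ) • A).PosSemidef)
    ∧ ({x : Fin q → ℂ | (X + z • A - B).mulVec x = 0} ⊆ {x | A.mulVec x = 0})
    ∧ (X + z • A - B = A * (Ap * X + z • (1 : Matrix (Fin q) (Fin q) ℂ) - Ap * B))
    ∧ (IsUnit (Ap * X + z • (1 : Matrix (Fin q) (Fin q) ℂ) - Ap * B)
       ∧ -(A * (Ap * X + z • (1 : Matrix (Fin q) (Fin q) ℂ) - Ap * B)⁻¹) = -(A * Wp * A)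
       ∧ {x : Fin q → ℂ | A.mulVec x = 0} ⊆ {x | (-(A * Wp * A)).mulVec x = 0}) := by
  obtain ⟨hA1, -, -, -⟩ := hAp
  obtain ⟨hW1, -, -, -⟩ := hWp
  have hz0 : z ≠ 0 := by
    rintro rfl
    simp at hz
  have hzA : ((z.im : ℂ) • A).PosSemidef :=
    hA.smul (by exact_mod_cast hz.le)
  have himz : (2 * Complex.I)⁻¹ * (z - star z) = (z.im : ℂ) := by
    have h := Complex.sub_conj z
    have h2 : z - star z = (z.im : ℂ) * (2 * Complex.I) := by
      rw [Complex.star_def, h]; push_cast; ring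
    rw [h2]
    field_simp
  have hW : X + z • A - B = (X - B) + z • A := by abel
  have hIm : matImag (X + z • A - B) - (z.im : ℂ) • A = matImag (X - B) := by
    rw [hW, ← himz]
    unfold matImag
    rw [conjTranspose_add, conjTranspose_smul, hA.1.eq]
    module
  have hb : ∀ x : Fin q → ℂ, (X + z • A - B).mulVec x = 0 → A.mulVec x = 0 := by
    intro x hx
    have h1 : star x ⬝ᵥ (matImag (X + z • A - B)).mulVec x = 0 := by
      unfold matImag
      rw [smul_mulVec, sub_mulVec, hx, zero_sub, dotProduct_smul, dotProduct_neg,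
        dotProduct_mulVec, ← star_mulVec, hx]
      simp
    have h2 : matImag (X + z • A - B) = matImag (X - B) + (z.im : ℂ) • A := by
      rw [← hIm]; abel
    rw [h2, add_mulVec, dotProduct_add] at h1
    have h3 := hImXB.dotProduct_mulVec_nonneg x
    have h4 := hzA.dotProduct_mulVec_nonneg x
    have h5 := ((add_eq_zero_iff_of_nonneg h3 h4).1 h1).2
    have h6 := (hzA.dotProduct_mulVec_zero_iff x).1 h5
    rw [smul_mulVec] at h6
    exact (smul_eq_zero.1 h6).resolve_left (by exact_mod_cast hz.ne')
  have hY : A * (Ap * (X - B)) = X - B := by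
    rw [Matrix.ext_iff_mulVec]
    intro v
    obtain ⟨u, hu⟩ := hran ⟨v, rfl⟩
    rw [← mulVec_mulVec, ← mulVec_mulVec, ← hu, mulVec_mulVec, mulVec_mulVec, hA1]
  have hM : Ap * X + z • (1 : Matrix (Fin q) (Fin q) ℂ) - Ap * B = Ap * (X - B) + z • 1 := by
    rw [Matrix.mul_sub]; abel
  have hc : X + z • A - B = A * (Ap * X + z • (1 : Matrix (Fin q) (Fin q) ℂ) - Ap * B) := by
    rw [hM, Matrix.mul_add, hY, hW]; simp
  have hU : IsUnit (Ap * X + z • (1 : Matrix (Fin q) (Fin q) ℂ) - Ap * B) := by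
    rw [← Matrix.mulVec_injective_iff_isUnit]
    rw [← Matrix.coe_mulVecLin, ← LinearMap.ker_eq_bot, LinearMap.ker_eq_bot']
    intro x hx
    rw [Matrix.mulVecLin_apply] at hx
    have h1 : A.mulVec x = 0 := by
      apply hb
      rw [hc, ← mulVec_mulVec, hx, mulVec_zero]
    have h2 : (X - B).mulVec x = 0 := hker h1
    rw [hM, add_mulVec, ← mulVec_mulVec, h2, mulVec_zero, zero_add, smul_mulVec, one_mulVec] at hx
    exact (smul_eq_zero.1 hx).resolve_left hz0
  refine ⟨⟨hIm ▸ hImXB, hzA⟩, hb, hc, hU, ?_, ?_⟩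
  · have h1 : A * (1 - Wp * (X + z • A - B)) = 0 := by
      have h0 : (X + z • A - B) * (1 - Wp * (X + z • A - B)) = 0 := by
        rw [Matrix.mul_sub, Matrix.mul_one, ← Matrix.mul_assoc, hW1, sub_self]
      rw [Matrix.ext_iff_mulVec]
      intro v
      rw [zero_mulVec, ← mulVec_mulVec]
      apply hb
      rw [mulVec_mulVec, h0, zero_mulVec]
    rw [Matrix.mul_sub, Matrix.mul_one, sub_eq_zero] at h1
    rw [Matrix.isUnit_iff_isUnit_det] at hU
    generalize Ap * X + z • (1 : Matrix (Fin q) (Fin q) ℂ) - Ap * B = M at *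
    have h2 : A = (X + z • A - B) * M⁻¹ := by
      conv_rhs => rw [hc]
      rw [Matrix.mul_nonsing_inv_cancel_right _ _ hU]
    generalize X + z • A - B = W at *
    rw [neg_inj]
    calc A * M⁻¹ = A * (Wp * W) * M⁻¹ := by rw [← h1]
      _ = A * Wp * (W * M⁻¹) := by simp only [Matrix.mul_assoc]
      _ = A * Wp * A := by rw [← h2]
  · intro x hx
    have hx' : A.mulVec x = 0 := hx
    change (-(A * Wp * A)).mulVec x = 0
    rw [neg_mulVec, ← mulVec_mulVec, hx', mulVec_zero, neg_zero]
end

section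
/- Let p, q ≥ 1, let 𝒢 be a nonempty subset of ℂ∖{0}, let F : 𝒢 → ℂ^{p×q}, let m ≥ 1, and let s_0, …, s_m ∈ ℂ^{p×q} be a first-term dominated sequence; set s_{−1} := 0 and s_{−1}^{(1)} := 0, and let (s_j^{(1)}) be the first Schur transform of (s_j). Suppose z ∈ 𝒢 satisfies ker F(z) = ker s_0 and range F(z) ⊆ range s_0. Put G(z) := −s_0·(z·I_q + (F(z))⁺·s_0) + s_1. Then z^{m−1}·G(z) + Σ_{j=0}^{m−1} z^{m−1−j}·s_{j−1}^{(1)} = F^{[m]}(z) + z^{−1}·s_0·(−z·F(z))⁺·Δ_m(z). -/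
open Matrix Complex Finset

theorem mp_unique_s4 {p q : ℕ} {M : Matrix (Fin p) (Fin q) ℂ} {A B : Matrix (Fin q) (Fin p) ℂ}
    (hA : IsMoorePenrose M A) (hB : IsMoorePenrose M B) : A = B := by
  obtain ⟨a1, a2, a3, a4⟩ := hA
  obtain ⟨b1, b2, b3, b4⟩ := hB
  have e1 : M * A = M * B := by
    have h : (M * B) * (M * A) = M * A := by rw [← Matrix.mul_assoc, b1]
    have h2 := congrArg conjTranspose h
    rw [conjTranspose_mul, a3, b3, ← Matrix.mul_assoc, a1] at h2
    exact h2.symm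
  have e2 : A * M = B * M := by
    have h : (A * M) * (B * M) = A * M := by rw [Matrix.mul_assoc, ← Matrix.mul_assoc M, b1]
    have h2 := congrArg conjTranspose h
    rw [conjTranspose_mul, a4, b4, Matrix.mul_assoc, ← Matrix.mul_assoc M, a1] at h2
    exact h2.symm
  rw [← a2, e2, Matrix.mul_assoc, e1, ← Matrix.mul_assoc, b2]

theorem mp_smul {p q : ℕ} {M : Matrix (Fin p) (Fin q) ℂ} {A : Matrix (Fin q) (Fin p) ℂ}
    (hA : IsMoorePenrose M A) (c : ℂ) (hc : c ≠ 0) : IsMoorePenrose (c • M) (c⁻¹ • A) := by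
  obtain ⟨a1, a2, a3, a4⟩ := hA
  refine ⟨?_, ?_, ?_, ?_⟩ <;>
    simp [Matrix.smul_mul, Matrix.mul_smul, smul_smul, hc, a1, a2, a3, a4,
      -conjTranspose_mul]

theorem ker_mul {p q : ℕ} {A B : Matrix (Fin p) (Fin q) ℂ} {Ap : Matrix (Fin q) (Fin p) ℂ}
    (hA : A * Ap * A = A)
    (h : {x : Fin q → ℂ | A.mulVec x = 0} ⊆ {x | B.mulVec x = 0}) : B * Ap * A = B := by
  have key : B * (1 - Ap * A) = 0 := by
    apply Matrix.ext_of_mulVec_single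
    intro i
    rw [← mulVec_mulVec, zero_mulVec]
    apply h
    show A.mulVec _ = 0
    rw [mulVec_mulVec, Matrix.mul_sub, ← Matrix.mul_assoc, hA, Matrix.mul_one, sub_self,
      zero_mulVec]
  rw [Matrix.mul_sub, Matrix.mul_one, ← Matrix.mul_assoc, sub_eq_zero] at key
  exact key.symm

theorem range_mul {p q : ℕ} {A B : Matrix (Fin p) (Fin q) ℂ} {Ap : Matrix (Fin q) (Fin p) ℂ}
    (hA : A * Ap * A = A)
    (h : Set.range B.mulVec ⊆ Set.range A.mulVec) : A * Ap * B = B := by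
  apply Matrix.ext_of_mulVec_single
  intro i
  obtain ⟨y, hy⟩ := h ⟨Pi.single i 1, rfl⟩
  rw [← mulVec_mulVec, ← hy, mulVec_mulVec, hA]

theorem sum_split {M : Type*} [AddCommMonoid M] (n : ℕ) (f : ℕ → ℕ → M) :
    ∑ k ∈ range (n+1), ∑ i ∈ range (n+2), f i k
      = ∑ l ∈ range (n+1), ∑ k ∈ range (l+1), f (l-k) k
        + ∑ j ∈ range (n+1), ∑ k ∈ Finset.Icc j n, f (n+1+j-k) k := by
  rw [Finset.sum_range_diag_flip (n+1) (fun k i => f i k)]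
  have h2 : ∑ j ∈ range (n+1), ∑ k ∈ Finset.Icc j n, f (n+1+j-k) k
      = ∑ k ∈ range (n+1), ∑ j ∈ range (k+1), f (n+1+j-k) k := by
    apply Finset.sum_comm'
    intro x y
    simp only [Finset.mem_range, Finset.mem_Icc]
    omega
  rw [h2, ← Finset.sum_add_distrib]
  apply Finset.sum_congr rfl
  intro k hk
  rw [Finset.mem_range] at hk
  have : n + 2 = (n + 1 - k) + (k + 1) := by omega
  rw [this, Finset.sum_range_add]
  congr 1
  apply Finset.sum_congr rfl
  intro j _
  congr 1
  omega

theorem sum_Icc_shift {M : Type*} [AddCommMonoid M] (n : ℕ) (f : ℕ → M) :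
    ∑ k ∈ Finset.Icc 1 n, f k = ∑ i ∈ range n, f (i+1) := by
  rw [Finset.range_eq_Ico, Finset.sum_Ico_add' f 0 n 1]
  rfl

/-- identity for the `(s₀,s₁)`-Schur transform `G` of `F` at a point `z`:
`z^(m-1) G(z) + Σ_{j=0}^{m-1} z^(m-1-j) s^{(1)}_{j-1} = F^{[m]}(z) + z⁻¹ s₀ (-z F(z))⁺ Δₘ(z)`
(with the conventions `s₋₁ = 0`, `s^{(1)}₋₁ = 0`).  Here `sr` is the reciprocal sequence
of `s`, `s1` its first Schur transform, and `FT k = F^{[k]}(z)`. -/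
theorem schur_transform_truncation_identity
    (p q : ℕ) (hp : 1 ≤ p) (hq : 1 ≤ q)
    (𝒢 : Set ℂ) (h𝒢ne : 𝒢.Nonempty) (h𝒢 : (0 : ℂ) ∉ 𝒢)
    (F : ℂ → Matrix (Fin p) (Fin q) ℂ)
    (m : ℕ) (hm : 1 ≤ m)
    (s : ℕ → Matrix (Fin p) (Fin q) ℂ)
    (hftd : ∀ j ≤ m, {x : Fin q → ℂ | (s 0).mulVec x = 0} ⊆ {x | (s j).mulVec x = 0}
      ∧ Set.range (s j).mulVec ⊆ Set.range (s 0).mulVec)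
    (s0p : Matrix (Fin q) (Fin p) ℂ) (hs0p : IsMoorePenrose (s 0) s0p)
    (sr : ℕ → Matrix (Fin q) (Fin p) ℂ)
    (hsr0 : sr 0 = s0p)
    (hsrk : ∀ k, 1 ≤ k → sr k = -(s0p * ∑ j ∈ Finset.range k, s (k - j) * sr j))
    (s1 : ℕ → Matrix (Fin p) (Fin q) ℂ)
    (hs1 : ∀ j, s1 j = -(s 0 * sr (j + 2) * s 0))
    (z : ℂ) (hz : z ∈ 𝒢)
    (hkerF : {x : Fin q → ℂ | (F z).mulVec x = 0} = {x | (s 0).mulVec x = 0})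
    (hranF : Set.range (F z).mulVec ⊆ Set.range (s 0).mulVec)
    (Fzp : Matrix (Fin q) (Fin p) ℂ) (hFzp : IsMoorePenrose (F z) Fzp)
    (nzFp : Matrix (Fin q) (Fin p) ℂ) (hnzFp : IsMoorePenrose ((-z) • F z) nzFp)
    (FT : ℕ → Matrix (Fin p) (Fin q) ℂ)
    (hFT : ∀ k, FT k = z ^ (k + 1) • F z + ∑ i ∈ Finset.range (k + 1), z ^ (k - i) • s i)
    (G : Matrix (Fin p) (Fin q) ℂ)
    (hG : G = -(s 0 * (z • (1 : Matrix (Fin q) (Fin q) ℂ) + Fzp * s 0)) + s 1)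
    (Δ : Matrix (Fin p) (Fin q) ℂ)
    (hΔ1 : m = 1 → Δ = (FT 1 - s 1) * s0p * (FT 1 - s 1))
    (hΔ2 : 2 ≤ m → Δ =
      (FT 1 - s 1) * s0p * FT m
      - FT m * s0p * (s 1 + ∑ j ∈ Finset.Icc 1 (m - 1), z ^ (-(j : ℤ)) • s1 (j - 1))
      + s m * s0p * s 1
      + ∑ k ∈ Finset.Icc 1 (m - 1), s (m - k) * s0p * s1 (k - 1)
      + ∑ j ∈ Finset.Icc 1 (m - 1), z ^ (-(j : ℤ)) •
          ∑ k ∈ Finset.Icc j (m - 1), s (m + j - k) * s0p * s1 (k - 1)) :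
    z ^ (m - 1) • G + ∑ i ∈ Finset.range (m - 1), z ^ (m - 2 - i) • s1 i
      = FT m + z⁻¹ • (s 0 * nzFp * Δ) := by
  have hz0 : z ≠ 0 := fun h => h𝒢 (h ▸ hz)
  obtain ⟨n, rfl⟩ : ∃ n, m = n + 1 := ⟨m - 1, by omega⟩
  have hnz : nzFp = (-z)⁻¹ • Fzp := mp_unique_s4 hnzFp (mp_smul hFzp (-z) (neg_ne_zero.mpr hz0))
  obtain ⟨m1, m2, m3, m4⟩ := hs0p
  have hsP : ∀ j ≤ n + 1, s 0 * s0p * s j = s j := fun j hj => range_mul m1 (hftd j hj).2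
  have hsQ : ∀ j ≤ n + 1, s j * s0p * s 0 = s j := fun j hj => ker_mul m1 (hftd j hj).1
  have hFQ : F z * s0p * s 0 = F z := ker_mul m1 hkerF.symm.subset
  have hFP : s 0 * s0p * F z = F z := range_mul m1 hranF
  have h0F : s 0 * Fzp * F z = s 0 := ker_mul hFzp.1 hkerF.subset
  have hsrQ : ∀ k, s0p * s 0 * sr k = sr k := by
    intro k
    rcases Nat.eq_zero_or_pos k with rfl | hk
    · rw [hsr0, m2]
    · rw [hsrk k hk, Matrix.mul_neg, ← Matrix.mul_assoc, m2]
  -- unified transform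
  obtain ⟨t, ht⟩ : ∃ t : ℕ → Matrix (Fin p) (Fin q) ℂ, ∀ j, t j = -(s 0 * sr (j+1) * s 0) :=
    ⟨_, fun _ => rfl⟩
  have hts : ∀ j, s1 j = t (j+1) := fun j => by rw [hs1, ht]
  have ht0 : t 0 = s 1 := by
    rw [ht, hsrk 1 le_rfl]
    simp only [Finset.sum_range_one, hsr0, Matrix.mul_neg, Matrix.neg_mul, neg_neg, Nat.sub_zero]
    rw [← Matrix.mul_assoc, ← Matrix.mul_assoc, hsP 1 (by omega), hsQ 1 (by omega)]
  have htP : ∀ j, s 0 * s0p * t j = t j := by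
    intro j
    rw [ht, Matrix.mul_neg, ← Matrix.mul_assoc, ← Matrix.mul_assoc, m1]
  have hst : ∀ j, s0p * t j = -(sr (j+1) * s 0) := by
    intro j
    rw [ht, Matrix.mul_neg, ← Matrix.mul_assoc, ← Matrix.mul_assoc, hsrQ]
  have hconv : ∀ l ≤ n, ∑ k ∈ range (l+1), s (l-k) * s0p * t k = s (l+1) := by
    intro l hl
    have e1 : ∑ k ∈ range (l+1), s (l-k) * s0p * t k
        = -((∑ k ∈ range (l+1), s (l-k) * sr (k+1)) * s 0) := by
      rw [Matrix.sum_mul, ← Finset.sum_neg_distrib]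
      refine Finset.sum_congr rfl fun k _ => ?_
      rw [Matrix.mul_assoc, hst, Matrix.mul_neg, Matrix.mul_assoc]
    have e2 : ∑ j ∈ range (l+2), s (l+1-j) * sr j
        = ∑ k ∈ range (l+1), s (l-k) * sr (k+1) + s (l+1) * s0p := by
      rw [Finset.sum_range_succ', hsr0]
      simp
    have e3 : ∑ j ∈ range (l+2), s (l+1-j) * sr j = 0 := by
      rw [Finset.sum_range_succ, Nat.sub_self]
      rw [hsrk (l+1) (by omega), Matrix.mul_neg, ← Matrix.mul_assoc, Matrix.mul_sum, ← sub_eq_add_neg, sub_eq_zero]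
      refine Finset.sum_congr rfl fun k _ => ?_
      rw [← Matrix.mul_assoc, hsP _ (by omega)]
    rw [e1, eq_neg_of_add_eq_zero_left (e2.symm.trans e3), Matrix.neg_mul, neg_neg,
      hsQ _ (by omega)]
  -- unified Delta
  have hΔ : Δ = (FT 1 - s 1) * s0p * FT (n+1)
      - FT (n+1) * s0p * (∑ j ∈ range (n+1), z ^ (-(j : ℤ)) • t j)
      + ∑ j ∈ range (n+1), z ^ (-(j : ℤ)) •
          ∑ k ∈ Finset.Icc j n, s (n+1+j-k) * s0p * t k := by
    rcases Nat.eq_zero_or_pos n with rfl | hn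
    · rw [hΔ1 rfl]
      simp only [zero_add, Finset.sum_range_one, Nat.cast_zero, neg_zero, zpow_zero, one_smul,
        Finset.Icc_self, Finset.sum_singleton, ht0, Nat.sub_zero, add_zero]
      simp only [Matrix.sub_mul, Matrix.mul_sub]
      abel
    · rw [hΔ2 (by omega), Nat.add_sub_cancel]
      have a1 : ∑ j ∈ range (n+1), z ^ (-(j : ℤ)) • t j
          = s 1 + ∑ j ∈ Finset.Icc 1 n, z ^ (-(j : ℤ)) • s1 (j - 1) := by
        rw [Finset.sum_range_succ', sum_Icc_shift, ht0, add_comm]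
        simp [hts]
      have a2 : ∑ k ∈ Finset.Icc 0 n, s (n+1+0-k) * s0p * t k
          = s (n+1) * s0p * s 1 + ∑ k ∈ Finset.Icc 1 n, s (n + 1 - k) * s0p * s1 (k - 1) := by
        have : Finset.Icc 0 n = range (n+1) := by
          ext
          simp only [Finset.mem_Icc, Finset.mem_range]
          omega
        rw [this, Finset.sum_range_succ', sum_Icc_shift, ht0, add_comm]
        simp [hts]
      have a3 : ∑ j ∈ range (n+1), z ^ (-(j : ℤ)) •
            ∑ k ∈ Finset.Icc j n, s (n+1+j-k) * s0p * t k
          = (s (n+1) * s0p * s 1 + ∑ k ∈ Finset.Icc 1 n, s (n + 1 - k) * s0p * s1 (k - 1))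
            + ∑ j ∈ Finset.Icc 1 n, z ^ (-(j : ℤ)) •
              ∑ k ∈ Finset.Icc j n, s (n + 1 + j - k) * s0p * s1 (k - 1) := by
        rw [Finset.sum_range_succ', a2, sum_Icc_shift 
            n (fun j => z ^ (-(j : ℤ)) • ∑ k ∈ Finset.Icc j n, s (n + 1 + j - k) * s0p * s1 (k - 1)),
          add_comm]
        congr 1
        · simp
        · refine Finset.sum_congr rfl fun j _ => ?_
          congr 1
          refine Finset.sum_congr rfl fun k hk => ?_
          rw [Finset.mem_Icc] at hk
          rw [hts, Nat.sub_add_cancel (by omega)]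
      rw [a1, a3]
      abel
  -- the cancellation
  have hS : (∑ i ∈ range (n+2), z ^ (n+1-i) • s i) * s0p *
        (∑ j ∈ range (n+1), z ^ (-(j : ℤ)) • t j)
      = ∑ l ∈ range (n+1), z ^ (n+1-l) • s (l+1)
        + ∑ j ∈ range (n+1), z ^ (-(j : ℤ)) •
          ∑ k ∈ Finset.Icc j n, s (n+1+j-k) * s0p * t k := by
    have b1 : (∑ i ∈ range (n+2), z ^ (n+1-i) • s i) * s0p *
        (∑ j ∈ range (n+1), z ^ (-(j : ℤ)) • t j)
        = ∑ k ∈ range (n+1), ∑ i ∈ range (n+2),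
          z ^ ((n:ℤ)+1-i-k) • (s i * s0p * t k) := by
      rw [Matrix.mul_sum]
      refine Finset.sum_congr rfl fun k _ => ?_
      rw [Matrix.sum_mul, Matrix.sum_mul]
      refine Finset.sum_congr rfl fun i hi => ?_
      rw [Finset.mem_range] at hi
      rw [Matrix.smul_mul, Matrix.smul_mul, Matrix.mul_smul, smul_smul, ← zpow_natCast,
        ← zpow_add₀ hz0]
      congr 2
      push_cast [Nat.cast_sub (show i ≤ n + 1 by omega)]
      ring
    rw [b1, sum_split n (fun i k => z ^ ((n:ℤ)+1-i-k) • (s i * s0p * t k))]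
    congr 1
    · refine Finset.sum_congr rfl fun l hl => ?_
      rw [Finset.mem_range] at hl
      rw [← hconv l (by omega), Finset.smul_sum]
      refine Finset.sum_congr rfl fun k hk => ?_
      rw [Finset.mem_range] at hk
      rw [← zpow_natCast]
      congr 2
      push_cast [Nat.cast_sub (show l ≤ n + 1 by omega), Nat.cast_sub (show k ≤ l by omega)]
      ring
    · refine Finset.sum_congr rfl fun j hj => ?_
      rw [Finset.smul_sum]
      refine Finset.sum_congr rfl fun k hk => ?_
      rw [Finset.mem_Icc] at hk
      congr 2
      push_cast [Nat.cast_sub (show k ≤ n + 1 + j by omega)]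
      ring
  have hFT1 : FT 1 - s 1 = z^2 • F z + z • s 0 := by
    rw [hFT, Finset.sum_range_succ, Finset.sum_range_one]
    simp [← add_assoc]
  have hPFT : s 0 * s0p * FT (n+1) = FT (n+1) := by
    rw [hFT, Matrix.mul_add, Matrix.mul_smul, hFP, Matrix.mul_sum]
    congr 1
    refine Finset.sum_congr rfl fun i hi => ?_
    rw [Finset.mem_range] at hi
    rw [Matrix.mul_smul, hsP _ (by omega)]
  have hΔ' : Δ = z^2 • (F z * s0p * FT (n+1)) + z^(n+3) • F z + z^(n+2) • s 0
      - z^(n+2) • (F z * s0p * (∑ j ∈ range (n+1), z ^ (-(j : ℤ)) • t j)) := by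
    rw [hΔ, hFT1, Matrix.add_mul, Matrix.add_mul, Matrix.smul_mul, Matrix.smul_mul,
      Matrix.smul_mul, Matrix.smul_mul, hPFT]
    set T := ∑ j ∈ range (n+1), z ^ (-(j : ℤ)) • t j with hT
    have c1 : FT (n+1) * s0p * T = z^(n+2) • (F z * s0p * T)
        + (∑ i ∈ range (n+2), z ^ (n+1-i) • s i) * s0p * T := by
      rw [hFT, Matrix.add_mul, Matrix.add_mul, Matrix.smul_mul, Matrix.smul_mul]
    have c2 : z • FT (n+1) = z^(n+3) • F z + z^(n+2) • s 0
        + ∑ l ∈ range (n+1), z ^ (n+1-l) • s (l+1) := by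
      rw [hFT, Finset.sum_range_succ', smul_add, smul_add, smul_smul, smul_smul,
        ← pow_succ', ← pow_succ', Finset.smul_sum]
      have : ∀ l ∈ range (n+1), z • z ^ (n+1-(l+1)) • s (l+1) = z ^ (n+1-l) • s (l+1) := by
        intro l hl
        rw [Finset.mem_range] at hl
        rw [smul_smul, ← pow_succ']
        congr 2
        omega
      rw [Finset.sum_congr rfl this]
      simp only [Nat.sub_zero]
      abel
    rw [c1, c2, hS]
    abel
  have hT : s 0 * s0p * (∑ j ∈ range (n+1), z ^ (-(j : ℤ)) • t j)
      = s 1 + ∑ i ∈ range n, z ^ (-((i:ℤ)+1)) • s1 i := by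
    rw [Matrix.mul_sum, Finset.sum_range_succ', add_comm]
    simp [htP, ht0, hts, hsP 1 (by omega), -neg_add_rev]
  have hsum : z ^ n • ∑ i ∈ range n, z ^ (-((i:ℤ)+1)) • s1 i
      = ∑ i ∈ range n, z ^ (n + 1 - 2 - i) • s1 i := by
    rw [Finset.smul_sum]
    refine Finset.sum_congr rfl fun i hi => ?_
    rw [Finset.mem_range] at hi
    rw [smul_smul, ← zpow_natCast, ← zpow_natCast, ← zpow_add₀ hz0]
    congr 2
    omega
  have hA : ∀ X : Matrix (Fin p) (Fin q) ℂ, s 0 * Fzp * (F z * s0p * X) = s 0 * s0p * X := by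
    intro X
    rw [← Matrix.mul_assoc, ← Matrix.mul_assoc, h0F]
  have hfin : s 0 * Fzp * Δ = z^2 • FT (n+1) + z^(n+3) • s 0 + z^(n+2) • (s 0 * Fzp * s 0)
      - z^(n+2) • (s 1 + ∑ i ∈ range n, z ^ (-((i:ℤ)+1)) • s1 i) := by
    rw [hΔ', Matrix.mul_sub, Matrix.mul_add, Matrix.mul_add]
    simp only [Matrix.mul_smul, hA]
    rw [hPFT, h0F, hT]
  rw [hnz, Matrix.mul_smul, Matrix.smul_mul, hfin, Nat.add_sub_cancel, ← hsum, hG,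
    Matrix.mul_add, Matrix.mul_smul, Matrix.mul_one, ← Matrix.mul_assoc]
  generalize ∑ i ∈ range n, z ^ (-((i:ℤ)+1)) • s1 i = U
  generalize s 0 * Fzp * s 0 = V
  have : z⁻¹ * (-z)⁻¹ = -(z^2)⁻¹ := by field_simp
  rw [smul_smul, this]
  match_scalars <;> field_simp <;> ring
end

section
/- Let p, q ≥ 1, let 𝒢 be a nonempty subset of ℂ∖{0}, let F : 𝒢 → ℂ^{p×q}, let m ≥ 1, and let s_0, …, s_m ∈ ℂ^{p×q} be a first-term dominated sequence; set s_{−1} := 0 and s_{−1}^{(1)} := 0, and let (s_j^{(1)}) be the first Schur transform of (s_j). Suppose z ∈ 𝒢 satisfies range F(z) ⊆ range s_0 and det(I_q + z^{−1}·s_0⁺·(F(z) − s_1)) ≠ 0. Put Y(z) := −s_0·(z·I_q + s_0⁺·(F(z) − s_1))⁺. Then z^{m+1}·Y(z) + Σ_{j=0}^{m+1} z^{m+1−j}·s_{j−1} = F_{(1)}^{[m−2]}(z) − z^{−1}·∇_m(z)·(I_q + z^{−1}·s_0⁺·(F(z) − s_1))^{−1}, where F_{(1)}^{[m−2]}(z)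 := z^{m−1}·F(z) + Σ_{j=0}^{m−1} z^{m−1−j}·s_{j−1}^{(1)}. -/
open Matrix Complex Finset

lemma aux_double {M : Type*} [AddCommMonoid M] (m : ℕ) (f : ℕ → ℕ → M) :
    ∑ k ∈ Finset.range m, ∑ j ∈ Finset.range (m + 1), f j k
      = ∑ n ∈ Finset.range m, ∑ k ∈ Finset.range (n + 1), f (n - k) k
        + ∑ j ∈ Finset.range m, ∑ k ∈ Finset.Ico j m, f (m + j - k) k := by
  have h1 := Finset.sum_range_diag_flip m (fun a b => f b a)
  have h2 : ∑ j ∈ Finset.range m, ∑ k ∈ Finset.Ico j m, f (m + j - k) k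
      = ∑ k ∈ Finset.range m, ∑ j ∈ Finset.range (k + 1), f (m + j - k) k := by
    apply Finset.sum_comm'
    intro x y
    simp only [Finset.mem_range, Finset.mem_Ico]
    omega
  rw [h1, h2, ← Finset.sum_add_distrib]
  refine Finset.sum_congr rfl fun k hk => ?_
  rw [Finset.mem_range] at hk
  rw [show m + 1 = (m - k) + (k + 1) by omega, Finset.sum_range_add]
  congr 1
  refine Finset.sum_congr rfl fun j _ => ?_
  congr 1
  omega

lemma aux_range {p q : ℕ} (A B : Matrix (Fin p) (Fin q) ℂ) (P : Matrix (Fin q) (Fin p) ℂ)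
    (h : A * P * A = A) (hr : Set.range B.mulVec ⊆ Set.range A.mulVec) : A * P * B = B := by
  apply Matrix.toLin'.injective
  ext1 i
  apply LinearMap.ext
  intro c
  simp only [LinearMap.comp_apply, Matrix.toLin'_apply]
  obtain ⟨y, hy⟩ := hr ⟨(LinearMap.single ℂ (fun _ => ℂ) i) c, rfl⟩
  rw [← Matrix.mulVec_mulVec, ← hy, Matrix.mulVec_mulVec, h]

lemma aux_ker {p q : ℕ} (A B : Matrix (Fin p) (Fin q) ℂ) (P : Matrix (Fin q) (Fin p) ℂ)
    (h : A * P * A = A)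
    (hr : {x : Fin q → ℂ | A.mulVec x = 0} ⊆ {x | B.mulVec x = 0}) : B * P * A = B := by
  apply Matrix.toLin'.injective
  ext1 i
  apply LinearMap.ext
  intro c
  simp only [LinearMap.comp_apply, Matrix.toLin'_apply]
  generalize (LinearMap.single ℂ (fun _ => ℂ) i) c = x
  have : B.mulVec ((P * A).mulVec x - x) = 0 := by
    apply hr
    simp only [Set.mem_ofPred_eq, Matrix.mulVec_sub, Matrix.mulVec_mulVec, ← Matrix.mul_assoc, h,
      sub_self]
  rw [Matrix.mulVec_sub, sub_eq_zero, Matrix.mulVec_mulVec, ← Matrix.mul_assoc] at this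
  exact this

/-- identity for the inverse `(s₀,s₁)`-Schur transform
`Y(z) = -s₀ (z I + s₀⁺(F(z)-s₁))⁺` of `F` at a point `z`:
`z^(m+1) Y(z) + Σ_{j=0}^{m+1} z^(m+1-j) s_{j-1}
  = F₍₁₎^{[m-2]}(z) - z⁻¹ ∇ₘ(z) (I + z⁻¹ s₀⁺(F(z)-s₁))⁻¹`
(with the conventions `s₋₁ = 0`, `s^{(1)}₋₁ = 0`). -/
theorem inverse_schur_transform_truncation_identity
    (p q : ℕ) (hp : 1 ≤ p) (hq : 1 ≤ q)
    (𝒢 : Set ℂ) (h𝒢ne : 𝒢.Nonempty) (h𝒢 : (0 : ℂ) ∉ 𝒢)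
    (F : ℂ → Matrix (Fin p) (Fin q) ℂ)
    (m : ℕ) (hm : 1 ≤ m)
    (s : ℕ → Matrix (Fin p) (Fin q) ℂ)
    (hftd : ∀ j ≤ m, {x : Fin q → ℂ | (s 0).mulVec x = 0} ⊆ {x | (s j).mulVec x = 0}
      ∧ Set.range (s j).mulVec ⊆ Set.range (s 0).mulVec)
    (s0p : Matrix (Fin q) (Fin p) ℂ) (hs0p : IsMoorePenrose (s 0) s0p)
    (sr : ℕ → Matrix (Fin q) (Fin p) ℂ)
    (hsr0 : sr 0 = s0p)
    (hsrk : ∀ k, 1 ≤ k → sr k = -(s0p * ∑ j ∈ Finset.range k, s (k - j) * sr j))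
    (s1 : ℕ → Matrix (Fin p) (Fin q) ℂ)
    (hs1 : ∀ j, s1 j = -(s 0 * sr (j + 2) * s 0))
    (z : ℂ) (hz : z ∈ 𝒢)
    (hranF : Set.range (F z).mulVec ⊆ Set.range (s 0).mulVec)
    (hdet : ((1 : Matrix (Fin q) (Fin q) ℂ) + z⁻¹ • (s0p * (F z - s 1))).det ≠ 0)
    (Wp : Matrix (Fin q) (Fin q) ℂ)
    (hWp : IsMoorePenrose (z • (1 : Matrix (Fin q) (Fin q) ℂ) + s0p * (F z - s 1)) Wp)
    (Y : Matrix (Fin p) (Fin q) ℂ) (hY : Y = -(s 0 * Wp))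
    (F1 : Matrix (Fin p) (Fin q) ℂ)
    (hF1 : F1 = z ^ (m - 1) • F z + ∑ i ∈ Finset.range (m - 1), z ^ (m - 2 - i) • s1 i)
    (N : Matrix (Fin p) (Fin q) ℂ)
    (hN1 : m = 1 → N = (F z - s 1) * s0p * (F z - s 1))
    (hN2 : 2 ≤ m → N =
      F1 * s0p * (F z - s 1)
      - ∑ j ∈ Finset.range m, z ^ (-(j : ℤ)) • (s (j + 1) * s0p * F1)
      + s m * s0p * s 1
      + ∑ k ∈ Finset.Icc 1 (m - 1), s (m - k) * s0p * s1 (k - 1)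
      + ∑ j ∈ Finset.Icc 1 (m - 1), z ^ (-(j : ℤ)) •
          ∑ k ∈ Finset.Icc j (m - 1), s (m + j - k) * s0p * s1 (k - 1)) :
    z ^ (m + 1) • Y + ∑ i ∈ Finset.range (m + 1), z ^ (m - i) • s i
      = F1 - z⁻¹ • (N * ((1 : Matrix (Fin q) (Fin q) ℂ) + z⁻¹ • (s0p * (F z - s 1)))⁻¹) := by
  have hz0 : z ≠ 0 := fun h => h𝒢 (h ▸ hz)
  obtain ⟨hP, -, -, -⟩ := hs0p
  have hR : ∀ j ≤ m, s 0 * s0p * s j = s j := fun j hj => aux_range _ _ _ hP (hftd j hj).2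
  have hK : ∀ j ≤ m, s j * s0p * s 0 = s j := fun j hj => aux_ker _ _ _ hP (hftd j hj).1
  have hFR : s 0 * s0p * F z = F z := aux_range _ _ _ hP hranF
  -- reciprocal identity
  let t : ℕ → Matrix (Fin p) (Fin q) ℂ := fun k => if k = 0 then s 1 else s1 (k - 1)
  have ht : ∀ k, s0p * t k = - (s0p * s 0 * sr (k + 1) * s 0) := by
    intro k
    by_cases hk : k = 0
    · subst hk
      have : sr 1 = -(s0p * (s 1 * s0p)) := by
        rw [hsrk 1 le_rfl]; simp [hsr0]
      simp only [t, if_true, zero_add, this]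
      have e : s0p * s 0 * -(s0p * (s 1 * s0p)) * s 0
          = -(s0p * (s 0 * s0p * (s 1 * s0p * s 0))) := by
        simp only [Matrix.mul_assoc, Matrix.mul_neg, Matrix.neg_mul]
      rw [e, hK 1 hm, hR 1 hm, neg_neg]
    · obtain ⟨k, rfl⟩ := Nat.exists_eq_succ_of_ne_zero hk
      simp [t, hs1, Matrix.mul_assoc]
  have hrec : ∀ n < m, ∑ k ∈ Finset.range (n + 1), s (n - k) * s0p * t k = s (n + 1) := by
    intro n hn
    have e1 : ∀ k ∈ Finset.range (n + 1), s (n - k) * s0p * t k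
        = - (s (n - k) * sr (k + 1) * s 0) := by
      intro k _
      rw [Matrix.mul_assoc, ht]
      have e : s (n - k) * -(s0p * s 0 * sr (k + 1) * s 0)
          = -((s (n - k) * s0p * s 0) * sr (k + 1) * s 0) := by
        simp only [Matrix.mul_assoc, Matrix.mul_neg]
      rw [e, hK _ (by omega)]
    rw [Finset.sum_congr rfl e1]
    have e2 : s 0 * sr (n + 1) = -∑ j ∈ Finset.range (n + 1), s (n + 1 - j) * sr j := by
      rw [hsrk (n + 1) (by omega), Matrix.mul_neg, ← Matrix.mul_assoc, Matrix.mul_sum]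
      congr 1
      refine Finset.sum_congr rfl fun j _ => ?_
      rw [← Matrix.mul_assoc, hR _ (by omega)]
    rw [Finset.sum_range_succ, Nat.sub_self, e2, Finset.sum_range_succ']
    simp only [Nat.add_sub_add_right, Nat.sub_zero, hsr0, Matrix.neg_mul, neg_neg, Matrix.add_mul,
      hK (n + 1) hn, Finset.sum_neg_distrib, Matrix.sum_mul]
    abel
  set D := F z - s 1 with hD
  set A := (1 : Matrix (Fin q) (Fin q) ℂ) + z⁻¹ • (s0p * D) with hA
  have hAu : IsUnit A.det := isUnit_iff_ne_zero.mpr hdet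
  have hW : z • (1 : Matrix (Fin q) (Fin q) ℂ) + s0p * D = z • A := by
    rw [hA, smul_add, smul_smul, mul_inv_cancel₀ hz0, one_smul]
  have hWpA : Wp * A = z⁻¹ • (1 : Matrix (Fin q) (Fin q) ℂ) := by
    have h := hWp.1
    rw [hW] at h
    simp only [Matrix.smul_mul, Matrix.mul_smul, smul_smul] at h
    have h2 : A⁻¹ * ((z * z) • (A * Wp * A)) = A⁻¹ * (z • A) := by rw [h]
    rw [Matrix.mul_smul, Matrix.mul_smul, Matrix.mul_assoc A, ← Matrix.mul_assoc A⁻¹,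
      Matrix.nonsing_inv_mul A hAu, Matrix.one_mul] at h2
    have h3 := congrArg (fun X => (z⁻¹ * z⁻¹) • X) h2
    simp only [smul_smul] at h3
    rw [show z⁻¹ * z⁻¹ * (z * z) = 1 by field_simp, show z⁻¹ * z⁻¹ * z = z⁻¹ by field_simp,
      one_smul] at h3
    exact h3
  -- uniform expression of N and F1
  set G := ∑ k ∈ Finset.range m, z ^ (m - 1 - k) • t k with hG
  have hF1' : F1 = z ^ (m - 1) • D + G := by
    obtain ⟨n, rfl⟩ : ∃ n, m = n + 1 := ⟨m - 1, by omega⟩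
    rw [hF1, hG, Finset.sum_range_succ', hD]
    have : ∀ k ∈ Finset.range n, z ^ (n + 1 - 1 - (k + 1)) • t (k + 1)
        = z ^ (n + 1 - 2 - k) • s1 k := by
      intro k _
      rw [show n + 1 - 1 - (k + 1) = n + 1 - 2 - k by omega]
      simp [t]
    rw [Finset.sum_congr rfl this]
    simp only [t, if_true, Nat.add_sub_cancel, Nat.sub_zero, smul_sub]
    abel
  have hN : N = F1 * s0p * D - ∑ j ∈ Finset.range m, z ^ (-(j : ℤ)) • (s (j + 1) * s0p * F1)
      + ∑ j ∈ Finset.range m, z ^ (-(j : ℤ)) • ∑ k ∈ Finset.Ico j m, s (m + j - k) * s0p * t k := by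
    have hNN : N = F1 * s0p * D
      - ∑ j ∈ Finset.range m, z ^ (-(j : ℤ)) • (s (j + 1) * s0p * F1)
      + s m * s0p * s 1
      + ∑ k ∈ Finset.Icc 1 (m - 1), s (m - k) * s0p * s1 (k - 1)
      + ∑ j ∈ Finset.Icc 1 (m - 1), z ^ (-(j : ℤ)) •
          ∑ k ∈ Finset.Icc j (m - 1), s (m + j - k) * s0p * s1 (k - 1) := by
      rcases Nat.lt_or_ge 1 m with h | h
      · exact hN2 h
      · obtain rfl : m = 1 := le_antisymm h hm
        rw [hN1 rfl]
        have : F1 = F z := by rw [hF1]; simp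
        rw [this]
        simp only [Nat.sub_self, Finset.sum_range_one, hD, Matrix.mul_sub, Matrix.sub_mul]
        simp
        abel
    rw [hNN]
    have hIcc : ∀ j, Finset.Icc j (m - 1) = Finset.Ico j m := by
      intro j; ext x; simp only [Finset.mem_Icc, Finset.mem_Ico]; omega
    have hs : ∀ j, 1 ≤ j → ∑ k ∈ Finset.Ico j m, s (m + j - k) * s0p * t k
        = ∑ k ∈ Finset.Ico j m, s (m + j - k) * s0p * s1 (k - 1) := by
      intro j hj
      refine Finset.sum_congr rfl fun k hk => ?_
      rw [Finset.mem_Ico] at hk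
      simp only [t, if_neg (show k ≠ 0 by omega)]
    have hs' : ∑ k ∈ Finset.Ico 1 m, s (m - k) * s0p * t k
        = ∑ k ∈ Finset.Ico 1 m, s (m - k) * s0p * s1 (k - 1) := by
      refine Finset.sum_congr rfl fun k hk => ?_
      rw [Finset.mem_Ico] at hk
      simp only [t, if_neg (show k ≠ 0 by omega)]
    rw [Finset.range_eq_Ico, Finset.sum_eq_sum_Ico_succ_bot (a := 0) (b := m) (by omega)
      (fun j => z ^ (-(j : ℤ)) • ∑ k ∈ Finset.Ico j m, s (m + j - k) * s0p * t k)]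
    rw [Finset.sum_eq_sum_Ico_succ_bot (a := 0) (b := m) (by omega)
      (fun k => s (m + 0 - k) * s0p * t k)]
    have hs2 : ∑ j ∈ Finset.Ico (0 + 1) m, z ^ (-(j : ℤ)) •
          ∑ k ∈ Finset.Ico j m, s (m + j - k) * s0p * t k
        = ∑ j ∈ Finset.Ico 1 m, z ^ (-(j : ℤ)) •
          ∑ k ∈ Finset.Ico j m, s (m + j - k) * s0p * s1 (k - 1) := by
      refine Finset.sum_congr rfl fun j hj => ?_
      rw [hs j (by rw [Finset.mem_Ico] at hj; omega)]
    rw [hs2]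
    simp only [hIcc, Nat.add_zero, zero_add, hs', Nat.cast_zero, neg_zero, zpow_zero, one_smul,
      Nat.sub_zero]
    have : t 0 = s 1 := by simp [t]
    rw [this]
    abel
  have htR : ∀ k, s 0 * s0p * t k = t k := by
    intro k
    by_cases hk : k = 0
    · simp only [t, hk, if_true]; exact hR 1 hm
    · simp only [t, if_neg hk, hs1, Matrix.mul_neg, ← Matrix.mul_assoc, hP]
  have hF1R : s 0 * s0p * F1 = F1 := by
    rw [hF1', hG, hD, Matrix.mul_add, Matrix.mul_smul, Matrix.mul_sub, hFR, hR 1 hm, Matrix.mul_sum]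
    simp only [Matrix.mul_smul, htR]
  -- key double sum
  have hkey : ∑ j ∈ Finset.range (m + 1), z ^ (-(j : ℤ)) • (s j * s0p * G)
      = ∑ i ∈ Finset.range m, z ^ (m - (i + 1)) • s (i + 1)
        + z⁻¹ • ∑ j ∈ Finset.range m, z ^ (-(j : ℤ)) •
          ∑ k ∈ Finset.Ico j m, s (m + j - k) * s0p * t k := by
    have h := aux_double m (fun j k => z ^ ((m : ℤ) - 1 - k - j) • (s j * s0p * t k))
    rw [Finset.sum_comm] at h
    refine Eq.trans ?_ (h.trans ?_)
    · refine Finset.sum_congr rfl fun j _ => ?_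
      rw [hG, Matrix.mul_sum, Finset.smul_sum]
      refine Finset.sum_congr rfl fun k hk => ?_
      rw [Finset.mem_range] at hk
      rw [Matrix.mul_smul, smul_smul, ← zpow_natCast, ← zpow_add₀ hz0]
      congr 2
      omega
    · congr 1
      · refine Finset.sum_congr rfl fun n hn => ?_
        rw [Finset.mem_range] at hn
        rw [← hrec n hn, Finset.smul_sum]
        refine Finset.sum_congr rfl fun k hk => ?_
        rw [Finset.mem_range] at hk
        rw [← zpow_natCast]
        congr 2
        omega
      · rw [Finset.smul_sum]
        refine Finset.sum_congr rfl fun j _ => ?_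
        rw [smul_smul, Finset.smul_sum]
        refine Finset.sum_congr rfl fun k hk => ?_
        rw [Finset.mem_Ico] at hk
        rw [← _root_.zpow_neg_one, ← zpow_add₀ hz0]
        congr 2
        omega
  have hsplit : ∑ j ∈ Finset.range (m + 1), z ^ (-(j : ℤ)) • (s j * s0p * F1)
      = z⁻¹ • ∑ j ∈ Finset.range m, z ^ (-(j : ℤ)) • (s (j + 1) * s0p * F1) + F1 := by
    rw [Finset.sum_range_succ', Finset.smul_sum]
    congr 1
    · refine Finset.sum_congr rfl fun j _ => ?_
      rw [smul_smul, ← _root_.zpow_neg_one, ← zpow_add₀ hz0]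
      congr 2
      push_cast
      ring
    · simp [hF1R]
  have hsplit2 : ∑ j ∈ Finset.range (m + 1), z ^ (-(j : ℤ)) • (s j * s0p * F1)
      = z⁻¹ • (∑ i ∈ Finset.range (m + 1), z ^ (m - i) • s i) * (s0p * D)
       + ∑ j ∈ Finset.range (m + 1), z ^ (-(j : ℤ)) • (s j * s0p * G) := by
    rw [Finset.smul_sum, Matrix.sum_mul, ← Finset.sum_add_distrib]
    refine Finset.sum_congr rfl fun j hj => ?_
    rw [Finset.mem_range] at hj
    rw [hF1', Matrix.mul_add, smul_add, Matrix.mul_smul, smul_smul, smul_smul, Matrix.smul_mul,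
      Matrix.mul_assoc]
    congr 2
    rw [← zpow_natCast, ← zpow_natCast, ← _root_.zpow_neg_one, ← zpow_add₀ hz0, ← zpow_add₀ hz0]
    congr 1
    omega
  have hS : ∑ i ∈ Finset.range (m + 1), z ^ (m - i) • s i
      = ∑ i ∈ Finset.range m, z ^ (m - (i + 1)) • s (i + 1) + z ^ m • s 0 := by
    rw [Finset.sum_range_succ', Nat.sub_zero]
  have hmain : (z ^ (m + 1) • Y + ∑ i ∈ Finset.range (m + 1), z ^ (m - i) • s i) * A
      = F1 * A - z⁻¹ • N := by
    have hYA : z ^ (m + 1) • Y * A = - (z ^ m • s 0) := by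
      rw [hY, Matrix.smul_mul, Matrix.neg_mul, Matrix.mul_assoc, hWpA, Matrix.mul_smul,
        Matrix.mul_one, smul_neg, smul_smul, pow_succ, mul_assoc, mul_inv_cancel₀ hz0, mul_one]
    rw [Matrix.add_mul, hYA, hN]
    have e1 := hsplit.symm.trans hsplit2
    rw [hkey] at e1
    set S := ∑ i ∈ Finset.range (m + 1), z ^ (m - i) • s i
    rw [hA, Matrix.mul_add, Matrix.mul_add, Matrix.mul_one, Matrix.mul_one, Matrix.mul_smul,
      Matrix.mul_smul, smul_add, smul_sub, ← Matrix.mul_assoc F1]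
    rw [Matrix.smul_mul] at e1
    generalize ∑ j ∈ Finset.range m, z ^ (-(j : ℤ)) • (s (j + 1) * s0p * F1) = X1 at e1 ⊢
    generalize ∑ j ∈ Finset.range m, z ^ (-(j : ℤ)) •
      ∑ k ∈ Finset.Ico j m, s (m + j - k) * s0p * t k = X2 at e1 ⊢
    generalize ∑ i ∈ Finset.range m, z ^ (m - (i + 1)) • s (i + 1) = X3 at e1 hS
    generalize S * (s0p * D) = X4 at e1 ⊢
    rw [hS, eq_sub_of_add_eq' e1]
    abel
  have hfin := congrArg (fun X => X * A⁻¹) hmain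
  simp only [Matrix.sub_mul, Matrix.mul_assoc, Matrix.mul_nonsing_inv A hAu, Matrix.mul_one,
    Matrix.smul_mul] at hfin
  exact hfin
end

section
/- Let p, q ≥ 1, let θ ∈ [0, 2π), let 𝒢 ⊆ ℂ∖{0} contain the ray {e^{iθ}·r : r ∈ [1, ∞)}, let F : 𝒢 → ℂ^{p×q}, let m ≥ 1, and let s_0, …, s_m ∈ ℂ^{p×q}; set s_{−1} := 0 and s_{−1}^{(1)} := 0, and let (s_j^{(1)}) be the first Schur transform of (s_j). Assume F^{[m]}(e^{iθ}·r) → 0 as r → ∞ (r real). Then, as r → ∞: if m = 1, Δ_m(e^{iθ}·r) → s_1·s_0⁺·s_1, and if m ≥ 2, Δ_m(e^{iθ}·r) → s_m·s_0⁺·s_1 + Σ_{k=1}^{m−1} s_{m−k}·s_0⁺·s_{k−1}^{(1)}. -/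
open Matrix Complex Finset Filter

theorem tendsto_mid_mul {p q : ℕ} (c : Matrix (Fin q) (Fin p) ℂ)
    (f g : ℝ → Matrix (Fin p) (Fin q) ℂ) (a b : Matrix (Fin p) (Fin q) ℂ)
    (hf : Filter.Tendsto f Filter.atTop (nhds a)) (hg : Filter.Tendsto g Filter.atTop (nhds b)) :
    Filter.Tendsto (fun r => f r * c * g r) Filter.atTop (nhds (a * c * b)) := by
  have hc : Continuous (fun x : Matrix (Fin p) (Fin q) ℂ × Matrix (Fin p) (Fin q) ℂ =>
      x.1 * c * x.2) :=
    (continuous_fst.matrix_mul continuous_const).matrix_mul continuous_snd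
  have h1 := hc.tendsto (a, b)
  rw [nhds_prod_eq] at h1
  have h2 := h1.comp (hf.prodMk hg)
  simpa only [Function.comp_def] using h2

/-- asymptotics of `Δₘ` along the ray `r ↦ e^{iθ} r`, assuming
`F^{[m]}(e^{iθ} r) → 0` as `r → ∞`. -/
theorem delta_limit_along_ray
    (p q : ℕ) (hp : 1 ≤ p) (hq : 1 ≤ q)
    (θ : ℝ) (hθ0 : 0 ≤ θ) (hθ2 : θ < 2 * Real.pi)
    (𝒢 : Set ℂ) (h𝒢 : (0 : ℂ) ∉ 𝒢)
    (hray : ∀ r : ℝ, 1 ≤ r → Complex.exp ((θ : ℂ) * Complex.I) * (r : ℂ) ∈ 𝒢)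
    (F : ℂ → Matrix (Fin p) (Fin q) ℂ)
    (m : ℕ) (hm : 1 ≤ m)
    (s : ℕ → Matrix (Fin p) (Fin q) ℂ)
    (s0p : Matrix (Fin q) (Fin p) ℂ) (hs0p : IsMoorePenrose (s 0) s0p)
    (sr : ℕ → Matrix (Fin q) (Fin p) ℂ)
    (hsr0 : sr 0 = s0p)
    (hsrk : ∀ k, 1 ≤ k → sr k = -(s0p * ∑ j ∈ Finset.range k, s (k - j) * sr j))
    (s1 : ℕ → Matrix (Fin p) (Fin q) ℂ)
    (hs1 : ∀ j, s1 j = -(s 0 * sr (j + 2) * s 0))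
    (FT : ℕ → ℂ → Matrix (Fin p) (Fin q) ℂ)
    (hFT : ∀ k z, FT k z = z ^ (k + 1) • F z + ∑ i ∈ Finset.range (k + 1), z ^ (k - i) • s i)
    (hlim : Filter.Tendsto (fun r : ℝ => FT m (Complex.exp ((θ : ℂ) * Complex.I) * (r : ℂ)))
      Filter.atTop (nhds (0 : Matrix (Fin p) (Fin q) ℂ)))
    (Δ : ℂ → Matrix (Fin p) (Fin q) ℂ)
    (hΔ1 : m = 1 → ∀ z : ℂ, Δ z = (FT 1 z - s 1) * s0p * (FT 1 z - s 1))
    (hΔ2 : 2 ≤ m → ∀ z : ℂ, Δ z =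
      (FT 1 z - s 1) * s0p * FT m z
      - FT m z * s0p * (s 1 + ∑ j ∈ Finset.Icc 1 (m - 1), z ^ (-(j : ℤ)) • s1 (j - 1))
      + s m * s0p * s 1
      + ∑ k ∈ Finset.Icc 1 (m - 1), s (m - k) * s0p * s1 (k - 1)
      + ∑ j ∈ Finset.Icc 1 (m - 1), z ^ (-(j : ℤ)) •
          ∑ k ∈ Finset.Icc j (m - 1), s (m + j - k) * s0p * s1 (k - 1)) :
    (m = 1 →
      Filter.Tendsto (fun r : ℝ => Δ (Complex.exp ((θ : ℂ) * Complex.I) * (r : ℂ)))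
        Filter.atTop (nhds (s 1 * s0p * s 1)))
    ∧ (2 ≤ m →
      Filter.Tendsto (fun r : ℝ => Δ (Complex.exp ((θ : ℂ) * Complex.I) * (r : ℂ)))
        Filter.atTop (nhds (s m * s0p * s 1
          + ∑ k ∈ Finset.Icc 1 (m - 1), s (m - k) * s0p * s1 (k - 1)))) := by
  set w : ℝ → ℂ := fun r => Complex.exp ((θ : ℂ) * Complex.I) * (r : ℂ) with hw
  have hinv : Filter.Tendsto (fun r : ℝ => (w r)⁻¹) Filter.atTop (nhds (0 : ℂ)) := by
    have h1 : Filter.Tendsto (fun r : ℝ => (Complex.exp ((θ : ℂ) * Complex.I))⁻¹ * ((r⁻¹ : ℝ) : ℂ))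
        Filter.atTop (nhds ((Complex.exp ((θ : ℂ) * Complex.I))⁻¹ * ((0 : ℝ) : ℂ))) :=
      ((Complex.continuous_ofReal.tendsto 0).comp tendsto_inv_atTop_zero).const_mul _
    simp only [Complex.ofReal_zero, mul_zero] at h1
    refine h1.congr fun r => ?_
    simp only [hw, mul_inv, Complex.ofReal_inv]
  have hwne : ∀ᶠ r : ℝ in Filter.atTop, w r ≠ 0 := by
    filter_upwards [Filter.eventually_ge_atTop (1 : ℝ)] with r hr h0
    exact h𝒢 (h0 ▸ hray r hr)
  have hrec : ∀ k z, FT (k + 1) z = z • FT k z + s (k + 1) := by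
    intro k z
    rw [hFT, hFT, Finset.sum_range_succ, smul_add, Finset.smul_sum, smul_smul, ← pow_succ',
      Nat.sub_self, pow_zero, one_smul, ← add_assoc]
    congr 2
    refine Finset.sum_congr rfl fun i hi => ?_
    have hi' : i ≤ k := by
      have := Finset.mem_range.mp hi
      omega
    rw [smul_smul, ← pow_succ', Nat.succ_sub hi']
  have hstep : ∀ k, Filter.Tendsto (fun r => FT (k + 1) (w r)) Filter.atTop (nhds 0) →
      Filter.Tendsto (fun r => FT k (w r)) Filter.atTop (nhds 0) := by
    intro k h
    have h1 := hinv.smul (h.sub (tendsto_const_nhds (x := s (k + 1))))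
    rw [zero_smul] at h1
    refine h1.congr' ?_
    filter_upwards [hwne] with r hr
    rw [hrec, add_sub_cancel_right, smul_smul, inv_mul_cancel₀ hr, one_smul]
  have hdown : ∀ n, Filter.Tendsto (fun r => FT (1 + n) (w r)) Filter.atTop (nhds 0) →
      Filter.Tendsto (fun r => FT 1 (w r)) Filter.atTop (nhds 0) := by
    intro n
    induction n with
    | zero => exact fun h => h
    | succ n ih => exact fun h => ih (hstep (1 + n) h)
  have hF1 : Filter.Tendsto (fun r => FT 1 (w r)) Filter.atTop (nhds 0) := by
    apply hdown (m - 1)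
    rw [Nat.add_sub_cancel' hm]
    exact hlim
  have hA := hF1.sub (tendsto_const_nhds (x := s 1))
  have hpow : ∀ j ∈ Finset.Icc 1 (m - 1),
      Filter.Tendsto (fun r => w r ^ (-(j : ℤ))) Filter.atTop (nhds 0) := by
    intro j hj
    have hj1 : j ≠ 0 := by
      have := (Finset.mem_Icc.mp hj).1
      omega
    have h1 := hinv.pow j
    rw [zero_pow hj1] at h1
    refine h1.congr fun r => ?_
    rw [_root_.zpow_neg, zpow_natCast, inv_pow]
  have hsum : ∀ c : ℕ → Matrix (Fin p) (Fin q) ℂ,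
      Filter.Tendsto (fun r => ∑ j ∈ Finset.Icc 1 (m - 1), w r ^ (-(j : ℤ)) • c j)
        Filter.atTop (nhds 0) := by
    intro c
    have h1 := tendsto_finsetSum (Finset.Icc 1 (m - 1))
      (fun j hj => (hpow j hj).smul_const (c j))
    simpa using h1
  have hmul : ∀ (f g : ℝ → Matrix (Fin p) (Fin q) ℂ) (a b : Matrix (Fin p) (Fin q) ℂ),
      Filter.Tendsto f Filter.atTop (nhds a) → Filter.Tendsto g Filter.atTop (nhds b) →
      Filter.Tendsto (fun r => f r * s0p * g r) Filter.atTop (nhds (a * s0p * b)) := by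
    exact fun f g a b hf hg => tendsto_mid_mul s0p f g a b hf hg
  constructor
  · intro h
    have h1 := hmul _ _ _ _ hA hA
    simp only [zero_sub, Matrix.neg_mul, Matrix.mul_neg, neg_neg] at h1
    exact h1.congr fun r => (hΔ1 h (w r)).symm
  · intro h
    have h1 := (((((hmul _ _ _ _ hA hlim).sub (hmul _ _ _ _ hlim
      ((tendsto_const_nhds (x := s 1)).add (hsum (fun j => s1 (j - 1)))))).add
      (tendsto_const_nhds (x := s m * s0p * s 1))).add
      (tendsto_const_nhds
        (x := ∑ k ∈ Finset.Icc 1 (m - 1), s (m - k) * s0p * s1 (k - 1)))).add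
      (hsum (fun j => ∑ k ∈ Finset.Icc j (m - 1), s (m + j - k) * s0p * s1 (k - 1))))
    simp only [Matrix.mul_zero, Matrix.zero_mul, sub_zero, zero_add, add_zero] at h1
    exact h1.congr fun r => (hΔ2 h (w r)).symm
end

section
/- Let p, q ≥ 1, let θ ∈ [0, 2π), let 𝒢 ⊆ ℂ∖{0} contain the ray {e^{iθ}·r : r ∈ [1, ∞)}, let F : 𝒢 → ℂ^{p×q}, let m ≥ 1, and let s_0, …, s_m ∈ ℂ^{p×q}; set s_{−1} := 0 and s_{−1}^{(1)} := 0, and let (s_j^{(1)}) be the first Schur transform of (s_j). Assume F_{(1)}^{[m−2]}(e^{iθ}·r) → 0 as r → ∞ (r real), where F_{(1)}^{[m−2]}(z) := z^{m−1}·F(z) + Σ_{j=0}^{m−1} z^{m−1−j}·s_{j−1}^{(1)}. Then, as r → ∞: if m = 1, ∇_m(e^{iθ}·r) → s_1·s_0⁺·s_1, and if m ≥ 2, ∇_m(e^{iθ}·r) → s_m·s_0⁺·s_1 + Σ_{k=1}^{m−1} s_{m−k}·s_0⁺·s_{k−1}^{(1)}. -/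
open Matrix Complex Finset Filter

/-- asymptotics of `∇ₘ` along the ray `r ↦ e^{iθ} r`, assuming
`F₍₁₎^{[m-2]}(e^{iθ} r) → 0` as `r → ∞`, where
`F₍₁₎^{[m-2]}(z) = z^(m-1) F(z) + Σ_{j=0}^{m-1} z^(m-1-j) s^{(1)}_{j-1}`. -/
theorem nabla_limit_along_ray
    (p q : ℕ) (hp : 1 ≤ p) (hq : 1 ≤ q)
    (θ : ℝ) (hθ0 : 0 ≤ θ) (hθ2 : θ < 2 * Real.pi)
    (𝒢 : Set ℂ) (h𝒢 : (0 : ℂ) ∉ 𝒢)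
    (hray : ∀ r : ℝ, 1 ≤ r → Complex.exp ((θ : ℂ) * Complex.I) * (r : ℂ) ∈ 𝒢)
    (F : ℂ → Matrix (Fin p) (Fin q) ℂ)
    (m : ℕ) (hm : 1 ≤ m)
    (s : ℕ → Matrix (Fin p) (Fin q) ℂ)
    (s0p : Matrix (Fin q) (Fin p) ℂ) (hs0p : IsMoorePenrose (s 0) s0p)
    (sr : ℕ → Matrix (Fin q) (Fin p) ℂ)
    (hsr0 : sr 0 = s0p)
    (hsrk : ∀ k, 1 ≤ k → sr k = -(s0p * ∑ j ∈ Finset.range k, s (k - j) * sr j))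
    (s1 : ℕ → Matrix (Fin p) (Fin q) ℂ)
    (hs1 : ∀ j, s1 j = -(s 0 * sr (j + 2) * s 0))
    (F1 : ℂ → Matrix (Fin p) (Fin q) ℂ)
    (hF1 : ∀ z : ℂ,
      F1 z = z ^ (m - 1) • F z + ∑ i ∈ Finset.range (m - 1), z ^ (m - 2 - i) • s1 i)
    (hlim : Filter.Tendsto (fun r : ℝ => F1 (Complex.exp ((θ : ℂ) * Complex.I) * (r : ℂ)))
      Filter.atTop (nhds (0 : Matrix (Fin p) (Fin q) ℂ)))
    (N : ℂ → Matrix (Fin p) (Fin q) ℂ)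
    (hN1 : m = 1 → ∀ z : ℂ, N z = (F z - s 1) * s0p * (F z - s 1))
    (hN2 : 2 ≤ m → ∀ z : ℂ, N z =
      F1 z * s0p * (F z - s 1)
      - ∑ j ∈ Finset.range m, z ^ (-(j : ℤ)) • (s (j + 1) * s0p * F1 z)
      + s m * s0p * s 1
      + ∑ k ∈ Finset.Icc 1 (m - 1), s (m - k) * s0p * s1 (k - 1)
      + ∑ j ∈ Finset.Icc 1 (m - 1), z ^ (-(j : ℤ)) •
          ∑ k ∈ Finset.Icc j (m - 1), s (m + j - k) * s0p * s1 (k - 1)) :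
    (m = 1 →
      Filter.Tendsto (fun r : ℝ => N (Complex.exp ((θ : ℂ) * Complex.I) * (r : ℂ)))
        Filter.atTop (nhds (s 1 * s0p * s 1)))
    ∧ (2 ≤ m →
      Filter.Tendsto (fun r : ℝ => N (Complex.exp ((θ : ℂ) * Complex.I) * (r : ℂ)))
        Filter.atTop (nhds (s m * s0p * s 1
          + ∑ k ∈ Finset.Icc 1 (m - 1), s (m - k) * s0p * s1 (k - 1)))) := by
  have hu : Filter.Tendsto (fun r : ℝ => (Complex.exp ((θ : ℂ) * Complex.I) * (r : ℂ))⁻¹)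
      Filter.atTop (nhds (0 : ℂ)) := by
    rw [tendsto_zero_iff_norm_tendsto_zero]
    have : (fun r : ℝ => ‖(Complex.exp ((θ : ℂ) * Complex.I) * (r : ℂ))⁻¹‖)
        = fun r : ℝ => |r⁻¹| := by
      funext r
      rw [norm_inv, norm_mul, Complex.norm_exp_ofReal_mul_I, one_mul, Complex.norm_real,
        Real.norm_eq_abs, abs_inv]
    rw [this]
    simpa using (tendsto_inv_atTop_zero (𝕜 := ℝ)).abs
  have hne : ∀ᶠ r : ℝ in Filter.atTop, Complex.exp ((θ : ℂ) * Complex.I) * (r : ℂ) ≠ 0 := by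
    filter_upwards [Filter.eventually_gt_atTop (0 : ℝ)] with r hr
    exact mul_ne_zero (Complex.exp_ne_zero _) (by exact_mod_cast hr.ne')
  have hF : ∀ z : ℂ, z ≠ 0 → F z = z⁻¹ ^ (m - 1) • F1 z
      - ∑ i ∈ Finset.range (m - 1), z⁻¹ ^ (i + 1) • s1 i := by
    intro z hz
    rw [hF1, smul_add, smul_smul, ← mul_pow, inv_mul_cancel₀ hz, one_pow, one_smul,
      Finset.smul_sum, eq_sub_iff_add_eq]
    congr 1
    refine Finset.sum_congr rfl fun i hi => ?_
    rw [Finset.mem_range] at hi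
    rw [smul_smul]
    congr 1
    have : m - 1 = (i + 1) + (m - 2 - i) := by omega
    rw [this, pow_add _ (i + 1) (m - 2 - i), mul_assoc, ← mul_pow, inv_mul_cancel₀ hz, one_pow, mul_one]
  have hFlim : Filter.Tendsto (fun r : ℝ => F (Complex.exp ((θ : ℂ) * Complex.I) * (r : ℂ)))
      Filter.atTop (nhds (0 : Matrix (Fin p) (Fin q) ℂ)) := by
    have hc : Continuous (fun x : ℂ × Matrix (Fin p) (Fin q) ℂ => x.1 ^ (m - 1) • x.2
      - ∑ i ∈ Finset.range (m - 1), x.1 ^ (i + 1) • s1 i) := by fun_prop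
    have h := (hc.tendsto (0, 0)).comp (hu.prodMk_nhds hlim)
    simp only [smul_zero, ne_eq, Nat.add_eq_zero_iff, one_ne_zero, and_false, not_false_eq_true,
      zero_pow, zero_smul, Finset.sum_const_zero, sub_zero] at h
    refine h.congr' ?_
    filter_upwards [hne] with r hr
    exact (hF _ hr).symm
  refine ⟨fun h1 => ?_, fun h2 => ?_⟩
  · have hc : Continuous (fun x : Matrix (Fin p) (Fin q) ℂ => (x - s 1) * s0p * (x - s 1)) := by
      fun_prop
    have h := (hc.tendsto 0).comp hFlim
    simp only [zero_sub, Matrix.neg_mul, Matrix.mul_neg, neg_neg] at h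
    refine h.congr fun r => ?_
    exact (hN1 h1 _).symm
  · have hc : Continuous (fun x : ℂ × Matrix (Fin p) (Fin q) ℂ × Matrix (Fin p) (Fin q) ℂ =>
      x.2.1 * s0p * (x.2.2 - s 1)
      - ∑ j ∈ Finset.range m, x.1 ^ j • (s (j + 1) * s0p * x.2.1)
      + s m * s0p * s 1
      + ∑ k ∈ Finset.Icc 1 (m - 1), s (m - k) * s0p * s1 (k - 1)
      + ∑ j ∈ Finset.Icc 1 (m - 1), x.1 ^ j •
          ∑ k ∈ Finset.Icc j (m - 1), s (m + j - k) * s0p * s1 (k - 1)) := by fun_prop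
    have h := (hc.tendsto (0, 0, 0)).comp (hu.prodMk_nhds (hlim.prodMk_nhds hFlim))
    have hz : ∑ j ∈ Finset.Icc 1 (m - 1), (0 : ℂ) ^ j •
          ∑ k ∈ Finset.Icc j (m - 1), s (m + j - k) * s0p * s1 (k - 1) = 0 := by
      refine Finset.sum_eq_zero fun j hj => ?_
      rw [Finset.mem_Icc] at hj
      rw [zero_pow (by omega), zero_smul]
    simp only [hz, Matrix.zero_mul, Matrix.mul_zero, smul_zero, Finset.sum_const_zero, sub_zero,
      zero_add, add_zero] at h
    refine h.congr fun r => ?_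
    rw [hN2 h2]
    simp only [Function.comp, _root_.zpow_neg, zpow_natCast, inv_pow]
end

section
/- Let q ≥ 1, let z ∈ ℂ∖{0}, and let A, B, X ∈ ℂ^{q×q} be such that A·A⁺·X = X, A·A⁺·B = B, and the matrix z·I_q + A⁺·(X − B) is invertible. Then −z²·A·(z·I_q + A⁺·(X − B))^{−1} + z·A + B = X − z^{−1}·(X − B)·A⁺·(X − B)·(I_q + z^{−1}·A⁺·(X − B))^{−1}. -/
open Matrix Complex

/-- algebraic identity behind the inverse `(A,B)`-Schur transform:
if `A A⁺ X = X`, `A A⁺ B = B` and `z I + A⁺(X - B)` is invertible (`z ≠ 0`), then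
`-z² A (z I + A⁺(X-B))⁻¹ + z A + B = X - z⁻¹ (X-B) A⁺ (X-B) (I + z⁻¹ A⁺(X-B))⁻¹`. -/
theorem inverse_schur_core_identity
    (q : ℕ) (hq : 1 ≤ q)
    (z : ℂ) (hz : z ≠ 0)
    (A B X Ap : Matrix (Fin q) (Fin q) ℂ)
    (hAp : IsMoorePenrose A Ap)
    (hX : A * Ap * X = X) (hB : A * Ap * B = B)
    (hU : IsUnit (z • (1 : Matrix (Fin q) (Fin q) ℂ) + Ap * (X - B))) :
    -(z ^ 2 • (A * (z • (1 : Matrix (Fin q) (Fin q) ℂ) + Ap * (X - B))⁻¹)) + z • A + B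
      = X - z⁻¹ • ((X - B) * Ap * (X - B) *
          ((1 : Matrix (Fin q) (Fin q) ℂ) + z⁻¹ • (Ap * (X - B)))⁻¹) := by
  have hD : A * Ap * (X - B) = X - B := by rw [mul_sub, hX, hB]
  obtain ⟨D, hDe⟩ : ∃ D, D = X - B := ⟨_, rfl⟩
  have hXB : X = D + B := by rw [hDe]; abel
  rw [← hDe] at hD hU ⊢
  have hM := Matrix.mul_nonsing_inv _ ((Matrix.isUnit_iff_isUnit_det _).1 hU)
  generalize hW : (z • (1 : Matrix (Fin q) (Fin q) ℂ) + Ap * D)⁻¹ = W at hM ⊢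
  have h2 : ((1 : Matrix (Fin q) (Fin q) ℂ) + z⁻¹ • (Ap * D))⁻¹ = z • W := by
    apply Matrix.inv_eq_right_inv
    refine Eq.trans ?_ hM
    simp [add_mul, smul_smul, hz]
  have h3 : Ap * D * W = 1 - z • W := by
    rw [← hM]; simp [add_mul]
  have h4 : D * W = A - z • (A * W) := by
    calc D * W = A * (Ap * D * W) := by
          rw [← mul_assoc, ← mul_assoc, hD]
      _ = _ := by rw [h3]; simp [mul_sub]
  have h5 : D * Ap * D * W = D - z • (D * W) := by
    calc D * Ap * D * W = D * (Ap * D * W) := by simp only [mul_assoc]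
      _ = _ := by rw [h3]; simp [mul_sub]
  rw [h2, mul_smul_comm, smul_smul, inv_mul_cancel₀ hz, one_smul, h5, h4, smul_sub, smul_smul, ← pow_two, hXB]
  abel
end

section
/- Let q ≥ 1 and let F : ℍ → ℂ^{q×q} be holomorphic with Im F(z) positive semidefinite for every z ∈ ℍ (i.e. F belongs to the Herglotz–Nevanlinna class R_q(ℍ)). Then for every z ∈ ℍ: ker((F(z))ᴴ) = ker(F(z)), range((F(z))ᴴ) = range(F(z)), and F(z)·(F(z))⁺ = (F(z))⁺·F(z). -/
open Matrix Complex
open scoped ComplexOrder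

theorem ep_ker {q : ℕ} (A : Matrix (Fin q) (Fin q) ℂ) (h : (matImag A).PosSemidef)
    (x : Fin q → ℂ) : Aᴴ.mulVec x = 0 ↔ A.mulVec x = 0 := by
  have hI : (2 * Complex.I)⁻¹ ≠ 0 := by simp
  have key : star x ⬝ᵥ ((A - Aᴴ) *ᵥ x) = 0 → A *ᵥ x = Aᴴ *ᵥ x := by
    intro h0
    have h1 : star x ⬝ᵥ (matImag A *ᵥ x) = 0 := by
      rw [matImag, smul_mulVec, dotProduct_smul, h0, smul_zero]
    have h2 := (h.dotProduct_mulVec_zero_iff x).1 h1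
    rw [matImag, smul_mulVec] at h2
    have h3 := (smul_eq_zero.1 h2).resolve_left hI
    rw [sub_mulVec] at h3
    exact sub_eq_zero.1 h3
  have e1 : star x ⬝ᵥ (Aᴴ *ᵥ x) = star (star x ⬝ᵥ (A *ᵥ x)) := by
    rw [star_dotProduct, star_mulVec, dotProduct_mulVec]
    simp [dotProduct_comm]
  have e2 : star x ⬝ᵥ ((A - Aᴴ) *ᵥ x)
      = star x ⬝ᵥ (A *ᵥ x) - star (star x ⬝ᵥ (A *ᵥ x)) := by
    rw [sub_mulVec, dotProduct_sub, e1]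
  constructor
  · intro h0
    have : star x ⬝ᵥ (A *ᵥ x) = 0 := by
      rw [h0, dotProduct_zero] at e1
      exact star_eq_zero.1 e1.symm
    rw [key (by rw [e2, this]; simp), h0]
  · intro h0
    rw [← key (by rw [e2, h0]; simp), h0]

theorem ep_mul {q : ℕ} (A B : Matrix (Fin q) (Fin q) ℂ) (h : (matImag A).PosSemidef) :
    Aᴴ * B = 0 ↔ A * B = 0 := by
  have hc : ∀ M : Matrix (Fin q) (Fin q) ℂ, M * B = 0 ↔ ∀ j, M *ᵥ (fun i => B i j) = 0 := by
    intro M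
    constructor
    · intro hM j
      ext i
      exact congrFun (congrFun hM i) j
    · intro hM
      ext i j
      exact congrFun (hM j) i
  rw [hc, hc]
  exact forall_congr' fun j => ep_ker A h _

/-- for a Herglotz–Nevanlinna function `F` and `z` in the upper half-plane,
`ker (F(z)ᴴ) = ker F(z)`, `range (F(z)ᴴ) = range F(z)` and `F(z) F(z)⁺ = F(z)⁺ F(z)`. -/
theorem herglotz_values_are_EP
    (q : ℕ) (hq : 1 ≤ q)
    (F Fp : ℂ → Matrix (Fin q) (Fin q) ℂ)
    (hHolo : ∀ i j, DifferentiableOn ℂ (fun z => F z i j) {z : ℂ | 0 < z.im})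
    (hPSD : ∀ z : ℂ, 0 < z.im → (matImag (F z)).PosSemidef)
    (hFp : ∀ z : ℂ, 0 < z.im → IsMoorePenrose (F z) (Fp z)) :
    ∀ z : ℂ, 0 < z.im →
      {x : Fin q → ℂ | (F z)ᴴ.mulVec x = 0} = {x | (F z).mulVec x = 0}
      ∧ Set.range ((F z)ᴴ).mulVec = Set.range (F z).mulVec
      ∧ F z * Fp z = Fp z * F z := by
  intro z hz
  have h := hPSD z hz
  obtain ⟨h1, h2, h3, h4⟩ := hFp z hz
  generalize F z = A at *
  generalize Fp z = P at *
  have a1 : P * A * A = A := by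
    have t : Aᴴ * (1 - P * A) = 0 := (ep_mul A _ h).2 (by
      rw [Matrix.mul_sub, ← Matrix.mul_assoc, h1, Matrix.mul_one, sub_self])
    have t2 := congrArg conjTranspose t
    rw [conjTranspose_mul, conjTranspose_sub, h4, conjTranspose_conjTranspose,
      conjTranspose_one, conjTranspose_zero, Matrix.sub_mul, Matrix.one_mul] at t2
    exact (sub_eq_zero.1 t2).symm
  have a2 : A * (A * P) = A := by
    have t0 : Aᴴ * (1 - A * P) = 0 := by
      have : ((1 - A * P) * A)ᴴ = 0 := by
        rw [Matrix.sub_mul, h1, Matrix.one_mul, sub_self, conjTranspose_zero]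
      rwa [conjTranspose_mul, conjTranspose_sub, h3, conjTranspose_one] at this
    have t := (ep_mul A _ h).1 t0
    rw [Matrix.mul_sub, Matrix.mul_one] at t
    exact (sub_eq_zero.1 t).symm
  have c : A * P = P * A := by
    calc A * P = (P * A * A) * P := by rw [a1]
      _ = P * (A * (A * P)) := by simp only [Matrix.mul_assoc]
      _ = P * A := by rw [a2]
  refine ⟨Set.ext fun x => ep_ker A h x, ?_, c⟩
  have r1 : Aᴴ = A * (P * Aᴴ) := by
    rw [← Matrix.mul_assoc, c, ← h4, ← conjTranspose_mul, ← Matrix.mul_assoc, h1]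
  have r2 : A = Aᴴ * (Pᴴ * A) := by
    rw [← Matrix.mul_assoc, ← conjTranspose_mul, h4, a1]
  apply Set.Subset.antisymm
  · rintro _ ⟨x, rfl⟩
    exact ⟨(P * Aᴴ) *ᵥ x, by rw [mulVec_mulVec, ← r1]⟩
  · rintro _ ⟨x, rfl⟩
    exact ⟨(Pᴴ * A) *ᵥ x, by rw [mulVec_mulVec, ← r2]⟩
end

section
/- Let p, q ≥ 1, let A ∈ ℂ^{p×q}, and let F : ℍ → ℂ^{q×q} be holomorphic with Im F(z) positive semidefinite for every z ∈ ℍ. Then the following are equivalent: (i) ker A ⊆ ker F(z) for all z ∈ ℍ; (ii) F(z)·A⁺·A = F(z) for all z ∈ ℍ; (iii) range F(z) ⊆ range(Aᴴ) for all z ∈ ℍ; (iv) A⁺·A·F(z) = F(z) for all z ∈ ℍ. Moreover, if p = q, these conditions hold, and range(Aᴴ) = range A, then A·A⁺·F(z) = F(z) and range F(z) ⊆ range A for all z ∈ ℍ. -/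
open Matrix Complex
open scoped ComplexOrder

theorem mulVec_conj_zero {q : ℕ} (M : Matrix (Fin q) (Fin q) ℂ) (h : (matImag M).PosSemidef)
    (x : Fin q → ℂ) : M.mulVec x = 0 ↔ Mᴴ.mulVec x = 0 := by
  have hc : (2 * Complex.I)⁻¹ ≠ 0 := by simp
  have e : ∀ x, (matImag M).mulVec x = (2 * Complex.I)⁻¹ • (M.mulVec x - Mᴴ.mulVec x) := by
    intro x
    rw [matImag, Matrix.smul_mulVec, Matrix.sub_mulVec]
  have k : star x ⬝ᵥ (M.mulVec x) = 0 → star x ⬝ᵥ (Mᴴ.mulVec x) = 0 →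
      M.mulVec x = Mᴴ.mulVec x := by
    intro h1 h2
    have h3 : star x ⬝ᵥ ((matImag M).mulVec x) = 0 := by
      rw [e, dotProduct_smul, dotProduct_sub, h1, h2]; simp
    have h4 := (h.dotProduct_mulVec_zero_iff x).1 h3
    rw [e] at h4
    exact sub_eq_zero.1 ((smul_eq_zero.1 h4).resolve_left hc)
  have c1 : star x ⬝ᵥ (Mᴴ.mulVec x) = star (star x ⬝ᵥ (M.mulVec x)) := by
    rw [← Matrix.star_dotProduct_star, star_star, Matrix.star_mulVec,
      Matrix.dotProduct_mulVec]
  constructor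
  · intro h0
    have h1 : star x ⬝ᵥ (M.mulVec x) = 0 := by rw [h0]; simp
    rw [← k h1 (by rw [c1, h1]; simp), h0]
  · intro h0
    have h2 : star x ⬝ᵥ (Mᴴ.mulVec x) = 0 := by rw [h0]; simp
    have h1 : star x ⬝ᵥ (M.mulVec x) = 0 := by
      rw [c1] at h2; exact star_eq_zero.1 h2
    rw [k h1 h2, h0]

theorem mul_conj_zero {q : ℕ} (M : Matrix (Fin q) (Fin q) ℂ) (h : (matImag M).PosSemidef)
    (N : Matrix (Fin q) (Fin q) ℂ) : M * N = 0 ↔ Mᴴ * N = 0 := by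
  have e : ∀ K : Matrix (Fin q) (Fin q) ℂ, K * N = 0 ↔ ∀ x, K.mulVec (N.mulVec x) = 0 := by
    intro K
    constructor
    · intro hh x
      rw [Matrix.mulVec_mulVec, hh, Matrix.zero_mulVec]
    · intro hh
      apply Matrix.ext_of_mulVec_single
      intro i
      rw [← Matrix.mulVec_mulVec, hh, Matrix.zero_mulVec]
  rw [e, e]
  exact forall_congr' fun x => mulVec_conj_zero M h _

theorem pt_range {m n k : ℕ} (M : Matrix (Fin m) (Fin n) ℂ) (B : Matrix (Fin m) (Fin k) ℂ)
    (P : Matrix (Fin m) (Fin m) ℂ) (hP : P * B = B)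
    (hr : Set.range M.mulVec ⊆ Set.range B.mulVec) : P * M = M := by
  apply Matrix.ext_of_mulVec_single
  intro i
  obtain ⟨y, hy⟩ := hr ⟨Pi.single i 1, rfl⟩
  rw [← Matrix.mulVec_mulVec, ← hy, Matrix.mulVec_mulVec, hP]

theorem pt_range' {m n k : ℕ} (M : Matrix (Fin m) (Fin n) ℂ) (B : Matrix (Fin m) (Fin k) ℂ)
    (C : Matrix (Fin k) (Fin n) ℂ) (hP : B * C = M) :
    Set.range M.mulVec ⊆ Set.range B.mulVec := by
  rintro _ ⟨x, rfl⟩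
  exact ⟨C.mulVec x, by rw [Matrix.mulVec_mulVec, hP]⟩

theorem pt_ker {p q : ℕ} (A : Matrix (Fin p) (Fin q) ℂ) (Ap : Matrix (Fin q) (Fin p) ℂ)
    (hAp : IsMoorePenrose A Ap) (M : Matrix (Fin q) (Fin q) ℂ) :
    {x : Fin q → ℂ | A.mulVec x = 0} ⊆ {x | M.mulVec x = 0} ↔ M * Ap * A = M := by
  obtain ⟨a1, a2, a3, a4⟩ := hAp
  constructor
  · intro h
    apply Matrix.ext_of_mulVec_single
    intro i
    have h1 : M.mulVec ((Ap * A).mulVec (Pi.single i 1) - Pi.single i 1) = 0 := by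
      apply h
      show A.mulVec _ = 0
      rw [Matrix.mulVec_sub, Matrix.mulVec_mulVec, ← Matrix.mul_assoc, a1, sub_self]
    rw [Matrix.mulVec_sub, Matrix.mulVec_mulVec, ← Matrix.mul_assoc] at h1
    exact sub_eq_zero.1 h1
  · intro h x hx
    show M.mulVec x = 0
    have hx' : A.mulVec x = 0 := hx
    rw [← h, ← Matrix.mulVec_mulVec, hx', Matrix.mulVec_zero]

theorem pt_iv {p q : ℕ} (A : Matrix (Fin p) (Fin q) ℂ) (Ap : Matrix (Fin q) (Fin p) ℂ)
    (hAp : IsMoorePenrose A Ap) (M : Matrix (Fin q) (Fin q) ℂ) (h : (matImag M).PosSemidef) :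
    {x : Fin q → ℂ | A.mulVec x = 0} ⊆ {x | M.mulVec x = 0} ↔ Ap * A * M = M := by
  rw [pt_ker A Ap hAp]
  obtain ⟨a1, a2, a3, a4⟩ := hAp
  have h1 := mul_conj_zero M h (Ap * A - 1)
  rw [Matrix.mul_sub, Matrix.mul_sub, sub_eq_zero, sub_eq_zero, Matrix.mul_one, Matrix.mul_one]
    at h1
  rw [Matrix.mul_assoc, h1, ← Matrix.conjTranspose_inj, Matrix.conjTranspose_mul, a4,
    Matrix.conjTranspose_conjTranspose]

theorem pt_iii {p q : ℕ} (A : Matrix (Fin p) (Fin q) ℂ) (Ap : Matrix (Fin q) (Fin p) ℂ)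
    (hAp : IsMoorePenrose A Ap) (M : Matrix (Fin q) (Fin q) ℂ) (h : (matImag M).PosSemidef) :
    {x : Fin q → ℂ | A.mulVec x = 0} ⊆ {x | M.mulVec x = 0} ↔
      Set.range M.mulVec ⊆ Set.range Aᴴ.mulVec := by
  rw [pt_iv A Ap hAp M h]
  obtain ⟨a1, a2, a3, a4⟩ := hAp
  constructor
  · intro h1
    apply pt_range' M Aᴴ (Apᴴ * M)
    rw [← Matrix.mul_assoc, ← Matrix.conjTranspose_mul, a4, h1]
  · apply pt_range
    rw [← a4, ← Matrix.conjTranspose_mul, ← Matrix.mul_assoc, a1]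

/-- for a Herglotz–Nevanlinna function `F` and `A ∈ ℂ^{p×q}`, the four
conditions (i) `ker A ⊆ ker F(z)` for all `z`, (ii) `F(z) A⁺ A = F(z)` for all `z`,
(iii) `range F(z) ⊆ range Aᴴ` for all `z`, (iv) `A⁺ A F(z) = F(z)` for all `z` are
equivalent; moreover, if `p = q`, the conditions hold and `range Aᴴ = range A` (i.e. `A`
is EP), then `A A⁺ F(z) = F(z)` and `range F(z) ⊆ range A` for all `z`. -/
theorem kernel_conditions_equiv
    (p q : ℕ) (hp : 1 ≤ p) (hq : 1 ≤ q)
    (A : Matrix (Fin p) (Fin q) ℂ) (Ap : Matrix (Fin q) (Fin p) ℂ)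
    (hAp : IsMoorePenrose A Ap)
    (F : ℂ → Matrix (Fin q) (Fin q) ℂ)
    (hHolo : ∀ i j, DifferentiableOn ℂ (fun z => F z i j) {z : ℂ | 0 < z.im})
    (hPSD : ∀ z : ℂ, 0 < z.im → (matImag (F z)).PosSemidef) :
    ((∀ z : ℂ, 0 < z.im → {x : Fin q → ℂ | A.mulVec x = 0} ⊆ {x | (F z).mulVec x = 0})
      ↔ (∀ z : ℂ, 0 < z.im → F z * Ap * A = F z))
    ∧ ((∀ z : ℂ, 0 < z.im → {x : Fin q → ℂ | A.mulVec x = 0} ⊆ {x | (F z).mulVec x = 0})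
      ↔ (∀ z : ℂ, 0 < z.im → Set.range (F z).mulVec ⊆ Set.range Aᴴ.mulVec))
    ∧ ((∀ z : ℂ, 0 < z.im → {x : Fin q → ℂ | A.mulVec x = 0} ⊆ {x | (F z).mulVec x = 0})
      ↔ (∀ z : ℂ, 0 < z.im → Ap * A * F z = F z))
    ∧ (∀ hpq : p = q,
        (∀ z : ℂ, 0 < z.im → {x : Fin q → ℂ | A.mulVec x = 0} ⊆ {x | (F z).mulVec x = 0}) →
        Set.range ((Matrix.reindex (finCongr hpq) (Equiv.refl (Fin q)) A)ᴴ).mulVec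
          = Set.range (Matrix.reindex (finCongr hpq) (Equiv.refl (Fin q)) A).mulVec →
        ∀ z : ℂ, 0 < z.im →
          Matrix.reindex (finCongr hpq) (Equiv.refl (Fin q)) A
              * Matrix.reindex (Equiv.refl (Fin q)) (finCongr hpq) Ap * F z = F z
          ∧ Set.range (F z).mulVec
              ⊆ Set.range (Matrix.reindex (finCongr hpq) (Equiv.refl (Fin q)) A).mulVec) := by
  refine ⟨forall₂_congr fun z _ => pt_ker A Ap hAp (F z),
    forall₂_congr fun z hz => pt_iii A Ap hAp (F z) (hPSD z hz),
    forall₂_congr fun z hz => pt_iv A Ap hAp (F z) (hPSD z hz), ?_⟩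
  intro hpq
  subst hpq
  intro h hr z hz
  have e1 : Matrix.reindex (finCongr rfl) (Equiv.refl (Fin p)) A = A := rfl
  have e2 : Matrix.reindex (Equiv.refl (Fin p)) (finCongr rfl) Ap = Ap := rfl
  rw [e1] at hr
  rw [e1, e2]
  have h3 := (pt_iii A Ap hAp (F z) (hPSD z hz)).1 (h z hz)
  rw [hr] at h3
  exact ⟨pt_range _ A _ hAp.1 h3, h3⟩
end

section
/- Let p, q ≥ 1 and let A, X ∈ ℂ^{p×q} with ker A ⊆ ker X and range A ⊆ range X. Then (−A⁺·X + I_q − A⁺·A)·(−X⁺·A + I_q − A⁺·A) = I_q; in particular the matrix −A⁺·X + I_q − A⁺·A is invertible with inverse −X⁺·A + I_q − A⁺·A. Moreover, −A⁺·(−A) + I_q − A⁺·A = I_q, so the matrix −A also lies in the domain of the corresponding linear fractional transformation. -/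
open Matrix Complex

/-- for `A, X ∈ ℂ^{p×q}` with `ker A ⊆ ker X` and `range A ⊆ range X`,
`(-A⁺X + I - A⁺A)(-X⁺A + I - A⁺A) = I`; in particular `-A⁺X + I - A⁺A` is invertible
with inverse `-X⁺A + I - A⁺A`.  Moreover `-A⁺(-A) + I - A⁺A = I`. -/
theorem lft_domain_invertibility
    (p q : ℕ) (hp : 1 ≤ p) (hq : 1 ≤ q)
    (A X : Matrix (Fin p) (Fin q) ℂ)
    (Ap Xp : Matrix (Fin q) (Fin p) ℂ)
    (hAp : IsMoorePenrose A Ap) (hXp : IsMoorePenrose X Xp)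
    (hker : {x : Fin q → ℂ | A.mulVec x = 0} ⊆ {x | X.mulVec x = 0})
    (hran : Set.range A.mulVec ⊆ Set.range X.mulVec) :
    (-(Ap * X) + 1 - Ap * A) * (-(Xp * A) + 1 - Ap * A) = 1
    ∧ IsUnit (-(Ap * X) + 1 - Ap * A)
    ∧ (-(Ap * X) + 1 - Ap * A)⁻¹ = -(Xp * A) + 1 - Ap * A
    ∧ -(Ap * (-A)) + 1 - Ap * A = 1 := by
  obtain ⟨a1, a2, a3, a4⟩ := hAp
  obtain ⟨x1, x2, x3, x4⟩ := hXp
  have hXP : X * (Ap * A) = X := by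
    have h : X * (1 - Ap * A) = 0 := by
      apply Matrix.ext_of_mulVec_single
      intro i
      have hz : A.mulVec ((1 - Ap * A).mulVec (Pi.single i 1)) = 0 := by
        rw [Matrix.mulVec_mulVec, Matrix.mul_sub, ← Matrix.mul_assoc, a1, Matrix.mul_one, sub_self, Matrix.zero_mulVec]
      have := hker hz
      simp only [Set.mem_ofPred_eq] at this
      rw [← Matrix.mulVec_mulVec, this, Matrix.zero_mulVec]
    rw [Matrix.mul_sub, Matrix.mul_one, sub_eq_zero] at h
    exact h.symm
  have hXA : X * (Xp * A) = A := by
    apply Matrix.ext_of_mulVec_single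
    intro i
    obtain ⟨y, hy⟩ := hran ⟨Pi.single i 1, rfl⟩
    rw [← Matrix.mul_assoc, ← Matrix.mulVec_mulVec, ← hy, Matrix.mulVec_mulVec, x1]
  have hPX : (Ap * A) * (Xp * X) = Xp * X := by
    have h : (Xp * X) * (Ap * A) = Xp * X := by rw [Matrix.mul_assoc, hXP]
    have h2 := congrArg Matrix.conjTranspose h
    rwa [Matrix.conjTranspose_mul, a4, x4] at h2
  have hPXp : (Ap * A) * Xp = Xp := by
    calc (Ap * A) * Xp = (Ap * A) * (Xp * X * Xp) := by rw [x2]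
      _ = (Ap * A) * (Xp * X) * Xp := by rw [Matrix.mul_assoc (Ap * A)]
      _ = Xp := by rw [hPX, x2]
  have e1 : (Ap * X) * (Xp * A) = Ap * A := by rw [Matrix.mul_assoc, hXA]
  have e2 : (Ap * X) * (Ap * A) = Ap * X := by rw [Matrix.mul_assoc, hXP]
  have e3 : (Ap * A) * (Xp * A) = Xp * A := by rw [← Matrix.mul_assoc, hPXp]
  have e4 : (Ap * A) * (Ap * A) = Ap * A := by rw [← Matrix.mul_assoc, a2]
  have key : (-(Ap * X) + 1 - Ap * A) * (-(Xp * A) + 1 - Ap * A) = 1 := by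
    generalize Ap * X = U at *
    generalize Xp * A = V at *
    generalize Ap * A = P at *
    have : (-U + 1 - P) * (-V + 1 - P)
        = U * V - U + U * P - V + 1 - P + P * V - P + P * P := by noncomm_ring
    rw [this, e1, e2, e3, e4]
    abel
  refine ⟨key, IsUnit.of_mul_eq_one _ key, Matrix.inv_eq_right_inv key, ?_⟩
  rw [Matrix.mul_neg, neg_neg]
  abel
end

section
/- Let p, q ≥ 1, let A, B ∈ ℂ^{p×q}, let z ∈ ℂ, and let X ∈ ℂ^{p×q} with ker A ⊆ ker X and range A ⊆ range X. Then: (a) the matrix −A⁺·X + I_q − A⁺·A is invertible and ((z·I_p − B·A⁺)·X + A)·(−A⁺·X + I_q − A⁺·A)^{−1} = −A·(z·I_q + X⁺·A) + B·A⁺·A; furthermore ker A ⊆ ker(−A·(z·I_q + X⁺·A) + B·A⁺·A) and range(−A·(z·I_q + X⁺·A)) ⊆ range A. (b) If in addition ker A ⊆ ker B, then ((z·I_p − B·A⁺)·X + A)·(−A⁺·X + I_q − A⁺·A)^{−1} = −A·(z·I_q + X⁺·A) + B and range(−A·(z·I_q + X⁺·A) + B − B) ⊆ range A. -/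
open Matrix Complex

/-- the linear fractional transformation generated by
`W_{A,B}(z) = [[z I_p - B A⁺, A], [-A⁺, I_q - A⁺ A]]` applied to `X` (where
`ker A ⊆ ker X` and `range A ⊆ range X`) equals `-A(z I_q + X⁺ A) + B A⁺ A`,
and equals `-A(z I_q + X⁺ A) + B` when additionally `ker A ⊆ ker B`. -/
theorem lft_of_schur_polynomial
    (p q : ℕ) (hp : 1 ≤ p) (hq : 1 ≤ q)
    (A B X : Matrix (Fin p) (Fin q) ℂ)
    (Ap Xp : Matrix (Fin q) (Fin p) ℂ)
    (hAp : IsMoorePenrose A Ap) (hXp : IsMoorePenrose X Xp)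
    (z : ℂ)
    (hker : {x : Fin q → ℂ | A.mulVec x = 0} ⊆ {x | X.mulVec x = 0})
    (hran : Set.range A.mulVec ⊆ Set.range X.mulVec) :
    (IsUnit (-(Ap * X) + 1 - Ap * A)
      ∧ ((z • (1 : Matrix (Fin p) (Fin p) ℂ) - B * Ap) * X + A)
            * (-(Ap * X) + 1 - Ap * A)⁻¹
          = -(A * (z • (1 : Matrix (Fin q) (Fin q) ℂ) + Xp * A)) + B * Ap * A
      ∧ {x : Fin q → ℂ | A.mulVec x = 0}
          ⊆ {x | (-(A * (z • (1 : Matrix (Fin q) (Fin q) ℂ) + Xp * A))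
              + B * Ap * A).mulVec x = 0}
      ∧ Set.range (-(A * (z • (1 : Matrix (Fin q) (Fin q) ℂ) + Xp * A))).mulVec
          ⊆ Set.range A.mulVec)
    ∧ ({x : Fin q → ℂ | A.mulVec x = 0} ⊆ {x | B.mulVec x = 0} →
        ((z • (1 : Matrix (Fin p) (Fin p) ℂ) - B * Ap) * X + A)
              * (-(Ap * X) + 1 - Ap * A)⁻¹
            = -(A * (z • (1 : Matrix (Fin q) (Fin q) ℂ) + Xp * A)) + B
        ∧ Set.range (-(A * (z • (1 : Matrix (Fin q) (Fin q) ℂ) + Xp * A)) + B - B).mulVec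
            ⊆ Set.range A.mulVec) := by
  obtain ⟨a1, a2, a3, a4⟩ := hAp
  obtain ⟨x1, x2, x3, x4⟩ := hXp
  have kerfact : ∀ C : Matrix (Fin p) (Fin q) ℂ,
      {x : Fin q → ℂ | A.mulVec x = 0} ⊆ {x | C.mulVec x = 0} → C * (Ap * A) = C := by
    intro C hC
    have h : C * (1 - Ap * A) = 0 := by
      apply Matrix.ext_of_mulVec_single
      intro i
      rw [← Matrix.mulVec_mulVec, Matrix.zero_mulVec]
      apply hC
      show A.mulVec _ = 0
      rw [Matrix.mulVec_mulVec, Matrix.mul_sub, ← Matrix.mul_assoc, a1,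
        Matrix.mul_one, sub_self, Matrix.zero_mulVec]
    rw [Matrix.mul_sub, Matrix.mul_one, sub_eq_zero] at h
    exact h.symm
  have hX : X * (Ap * A) = X := kerfact X hker
  have hA : X * (Xp * A) = A := by
    apply Matrix.ext_of_mulVec_single
    intro i
    obtain ⟨y, hy⟩ := hran ⟨Pi.single i 1, rfl⟩
    rw [← Matrix.mulVec_mulVec, ← Matrix.mulVec_mulVec, ← hy, Matrix.mulVec_mulVec,
      Matrix.mulVec_mulVec, x1]
  have hP : Ap * A * (Xp * X) = Xp * X := by
    have h : Xp * X * (Ap * A) = Xp * X := by rw [Matrix.mul_assoc, hX]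
    have h2 := congrArg Matrix.conjTranspose h
    rwa [Matrix.conjTranspose_mul, a4, x4] at h2
  have hXp : Ap * (A * (Xp * A)) = Xp * A := by
    calc Ap * (A * (Xp * A)) = Ap * A * (Xp * X) * (Xp * A) := by
          simp only [Matrix.mul_assoc, hA]
      _ = Xp * A := by rw [hP]; simp only [Matrix.mul_assoc, hA]
  have a1' : A * (Ap * A) = A := by rw [← Matrix.mul_assoc, a1]
  have hNM : (-(Ap * X) + 1 - Ap * A) * (-(Xp * A) + 1 - Ap * A) = 1 := by
    simp only [Matrix.mul_add, Matrix.add_mul, Matrix.mul_sub, Matrix.sub_mul, Matrix.neg_mul,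
      Matrix.mul_neg, Matrix.mul_assoc, hX, hA, hXp, a1', Matrix.mul_one, Matrix.one_mul]
    abel
  have hinv : (-(Ap * X) + 1 - Ap * A)⁻¹ = -(Xp * A) + 1 - Ap * A :=
    Matrix.inv_eq_right_inv hNM
  have main : ((z • (1 : Matrix (Fin p) (Fin p) ℂ) - B * Ap) * X + A)
            * (-(Ap * X) + 1 - Ap * A)⁻¹
          = -(A * (z • (1 : Matrix (Fin q) (Fin q) ℂ) + Xp * A)) + B * Ap * A := by
    rw [hinv]
    simp only [Matrix.mul_add, Matrix.add_mul, Matrix.mul_sub, Matrix.sub_mul, Matrix.neg_mul,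
      Matrix.mul_neg, Matrix.mul_assoc, hX, hA, a1', Matrix.mul_one, Matrix.one_mul,
      Matrix.smul_mul, Matrix.mul_smul]
    abel
  have hr : Set.range (-(A * (z • (1 : Matrix (Fin q) (Fin q) ℂ) + Xp * A))).mulVec
          ⊆ Set.range A.mulVec := by
    rintro _ ⟨y, rfl⟩
    refine ⟨(-(z • (1 : Matrix (Fin q) (Fin q) ℂ) + Xp * A)).mulVec y, ?_⟩
    rw [Matrix.mulVec_mulVec, Matrix.mul_neg]
  refine ⟨⟨?_, main, ?_, hr⟩, ?_⟩
  · exact (Matrix.isUnit_iff_isUnit_det _).2 (Matrix.isUnit_det_of_right_inverse hNM)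
  · intro x hx
    have hx' : A.mulVec x = 0 := hx
    show Matrix.mulVec _ x = 0
    have e : -(A * (z • (1 : Matrix (Fin q) (Fin q) ℂ) + Xp * A)) + B * Ap * A
        = (-(z • (1 : Matrix (Fin p) (Fin p) ℂ)) - A * Xp + B * Ap) * A := by
      simp only [Matrix.mul_add, Matrix.add_mul, Matrix.sub_mul, Matrix.neg_mul,
        Matrix.mul_assoc, Matrix.mul_one, Matrix.one_mul, Matrix.smul_mul, Matrix.mul_smul]
      abel
    rw [e, ← Matrix.mulVec_mulVec, hx', Matrix.mulVec_zero]
  · intro hB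
    refine ⟨?_, ?_⟩
    · rw [main, Matrix.mul_assoc B, kerfact B hB]
    · rw [add_sub_cancel_right]
      exact hr
end

section
/- Let q ≥ 1 and let s, A ∈ ℂ^{q×q} be Hermitian with 0 ⪯ s ⪯ A and rank s = rank A. Then the matrix (A − s)·s⁺·A is positive semidefinite, and A·(A·s⁺·A)⁺·A = s. -/
open Matrix Complex
open scoped ComplexOrder

lemma aux_ker_le {q : ℕ} {s A : Matrix (Fin q) (Fin q) ℂ}
    (hsPSD : s.PosSemidef) (hAs : (A - s).PosSemidef) (x : Fin q → ℂ) (hx : A *ᵥ x = 0) :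
    s *ᵥ x = 0 := by
  have h1 := hAs.dotProduct_mulVec_nonneg x
  have h2 := hsPSD.dotProduct_mulVec_nonneg x
  rw [Matrix.sub_mulVec, hx, zero_sub, dotProduct_neg] at h1
  exact (hsPSD.dotProduct_mulVec_zero_iff x).1 (le_antisymm (neg_nonneg.1 h1) h2)

lemma aux_ker_ge {q : ℕ} {s A : Matrix (Fin q) (Fin q) ℂ}
    (h : ∀ x, A *ᵥ x = 0 → s *ᵥ x = 0) (hrank : s.rank = A.rank)
    (x : Fin q → ℂ) (hx : s *ᵥ x = 0) : A *ᵥ x = 0 := by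
  have hle : LinearMap.ker A.mulVecLin ≤ LinearMap.ker s.mulVecLin := by
    intro y hy
    simp only [LinearMap.mem_ker, Matrix.mulVecLin_apply] at hy ⊢
    exact h y hy
  have e1 := LinearMap.finrank_range_add_finrank_ker A.mulVecLin
  have e2 := LinearMap.finrank_range_add_finrank_ker s.mulVecLin
  unfold Matrix.rank at hrank
  have e := Submodule.eq_of_le_of_finrank_eq hle (by omega)
  have hx' : x ∈ LinearMap.ker s.mulVecLin := by simpa using hx
  rw [← e] at hx'
  simpa using hx'

lemma aux_mat {q : ℕ} {s A : Matrix (Fin q) (Fin q) ℂ}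
    (h : ∀ x, A *ᵥ x = 0 → s *ᵥ x = 0) {X Y : Matrix (Fin q) (Fin q) ℂ}
    (hX : A * X = A * Y) : s * X = s * Y := by
  rw [← sub_eq_zero, ← Matrix.mul_sub] at hX ⊢
  apply Matrix.ext_of_mulVec_single
  intro i
  rw [← Matrix.mulVec_mulVec, Matrix.zero_mulVec]
  apply h
  rw [Matrix.mulVec_mulVec, hX, Matrix.zero_mulVec]

/-- for Hermitian `s, A` with `0 ⪯ s ⪯ A` and `rank s = rank A`,
the matrix `(A - s) s⁺ A` is positive semidefinite and `A (A s⁺ A)⁺ A = s`. -/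
theorem schur_parameter_recovery
    (q : ℕ) (hq : 1 ≤ q)
    (s A : Matrix (Fin q) (Fin q) ℂ)
    (hs : s.IsHermitian) (hA : A.IsHermitian)
    (hsPSD : s.PosSemidef) (hAs : (A - s).PosSemidef)
    (hrank : s.rank = A.rank)
    (sp Mp : Matrix (Fin q) (Fin q) ℂ)
    (hsp : IsMoorePenrose s sp)
    (hMp : IsMoorePenrose (A * sp * A) Mp) :
    ((A - s) * sp * A).PosSemidef ∧ A * Mp * A = s := by
  have hk := fun x => aux_ker_le hsPSD hAs x
  have hk' := fun x => aux_ker_ge hk hrank x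
  obtain ⟨p1, p2, p3, p4⟩ := hsp
  obtain ⟨m1, -, -, -⟩ := hMp
  -- `P = sp * s` equals `Q = s * sp`
  have sQ : s * (s * sp) = s := by
    have := congrArg conjTranspose p1
    rwa [conjTranspose_mul, p3, hs.eq] at this
  have Ps : sp * s * s = s := by
    have := congrArg conjTranspose p1
    rwa [Matrix.mul_assoc, conjTranspose_mul, p4, hs.eq] at this
  have hPQ : sp * s = s * sp := by
    calc sp * s = sp * (s * (s * sp)) := by rw [sQ]
      _ = sp * s * s * sp := by simp only [Matrix.mul_assoc]
      _ = s * sp := by rw [Ps]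
  have c1 : s * spᴴ = sp * s := by rw [← p4, conjTranspose_mul, hs.eq]
  have c2 : spᴴ * s = s * sp := by rw [← p3, conjTranspose_mul, hs.eq]
  have hspH : spᴴ = sp := by
    calc spᴴ = (sp * s * sp)ᴴ := by rw [p2]
      _ = spᴴ * (s * spᴴ) := by simp only [conjTranspose_mul, hs.eq, Matrix.mul_assoc]
      _ = spᴴ * s * sp := by rw [c1, hPQ, Matrix.mul_assoc]
      _ = sp := by rw [c2, ← hPQ, p2]
  have hspPSD : sp.PosSemidef := by
    have := hsPSD.mul_mul_conjTranspose_same sp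
    rwa [hspH, p2] at this
  have a1 : A * sp * s = A := by
    have : A * (sp * s) = A * 1 := aux_mat hk' (by rw [← Matrix.mul_assoc, p1, Matrix.mul_one])
    rwa [← Matrix.mul_assoc, Matrix.mul_one] at this
  have a2 : s * sp * A = A := by
    have := congrArg conjTranspose a1
    rwa [conjTranspose_mul, conjTranspose_mul, hs.eq, hA.eq, hspH, ← Matrix.mul_assoc] at this
  constructor
  · have h := (hspPSD.mul_mul_conjTranspose_same (A - s)).add hAs
    rw [hAs.1.eq] at h
    have e : (A - s) * sp * A = (A - s) * sp * (A - s) + (A - s) := by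
      simp only [Matrix.sub_mul, Matrix.mul_sub, a1, a2, p1]
      abel
    rwa [e]
  · have e1 : A * (Mp * (A * sp * A)) = A := by
      have h := aux_mat hk (X := sp * A * Mp * (A * sp * A)) (Y := sp * A)
        (by simpa only [Matrix.mul_assoc] using m1)
      simp only [← Matrix.mul_assoc] at h ⊢
      rwa [a2] at h
    have e2 : A * (sp * A * Mpᴴ * A) = A * 1 := by
      have := congrArg conjTranspose e1
      simpa only [conjTranspose_mul, hA.eq, hspH, Matrix.mul_assoc, Matrix.mul_one] using this
    have e3 := congrArg conjTranspose (aux_mat hk e2)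
    simp only [conjTranspose_mul, hA.eq, hs.eq, hspH, conjTranspose_conjTranspose,
      Matrix.mul_one] at e3
    calc A * Mp * A = A * Mp * (A * sp * s) := by rw [a1]
      _ = s := by simpa only [Matrix.mul_assoc] using e3
end
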